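/- arXiv:2503.11852 — 14 statements merged into one kernel-verified Lean document; each statement's English description precedes it below -/
import Mathlib

section
/- Let U ⊆ ℝ² be an open set, let (a,b,c,d) be a Nijenhuis operator on U whose trace satisfies a(x,y)+d(x,y) = x on U, let f = a·d − b·c, and assume ∂f/∂y(p) ≠ 0 for every p ∈ U. Then on all of U one has a = x − ∂f/∂x, b = −∂f/∂y, d = ∂f/∂x, and c = (∂f/∂x · (x − ∂f/∂x) − f)/(−∂f/∂y). -/
open Real Set

/-- Partial derivative with respect to the first coordinate `x`. -/
noncomputable def pdx (f : ℝ × ℝ → ℝ) (p : ℝ × ℝ) : ℝ := fderiv ℝ f p (1, 0)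

/-- Partial derivative with respect to the second coordinate `y`. -/
noncomputable def pdy (f : ℝ × ℝ → ℝ) (p : ℝ × ℝ) : ℝ := fderiv ℝ f p (0, 1)

/-- A quadruple `(a,b,c,d)` of smooth functions on `U ⊆ ℝ²` is a Nijenhuis operator if the
two essential components of the Nijenhuis torsion of `L = [[a,b],[c,d]]` vanish on `U`. -/
def IsNijenhuisOn (U : Set (ℝ × ℝ)) (a b c d : ℝ × ℝ → ℝ) : Prop :=
  ContDiffOn ℝ (⊤ : ℕ∞) a U ∧ ContDiffOn ℝ (⊤ : ℕ∞) b U ∧ ContDiffOn ℝ (⊤ : ℕ∞) c U ∧ ContDiffOn ℝ (⊤ : ℕ∞) d U ∧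
  ∀ p ∈ U,
    pdy a p * (a p - d p) + pdy (fun q => b q * c q) p - pdx (fun q => a q + d q) p * b p = 0 ∧
    pdx d p * (a p - d p) - pdx (fun q => b q * c q) p + pdy (fun q => a q + d q) p * c p = 0

theorem stmt0 (U : Set (ℝ × ℝ)) (hU : IsOpen U) (a b c d : ℝ × ℝ → ℝ)
    (hN : IsNijenhuisOn U a b c d)
    (htr : ∀ p ∈ U, a p + d p = p.1)
    (f : ℝ × ℝ → ℝ) (hf : f = fun p => a p * d p - b p * c p)
    (hfy : ∀ p ∈ U, pdy f p ≠ 0) :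
    ∀ p ∈ U,
      a p = p.1 - pdx f p ∧
      b p = -pdy f p ∧
      d p = pdx f p ∧
      c p = (pdx f p * (p.1 - pdx f p) - f p) / (-pdy f p) := by
  subst hf
  obtain ⟨ha, hb, hc, hd, hT⟩ := hN
  intro p hp
  have hUp : U ∈ nhds p := hU.mem_nhds hp
  have differentiableAt_of_contDiffOn {g : ℝ × ℝ → ℝ} (hg : ContDiffOn ℝ (⊤ : ℕ∞) g U) :
      DifferentiableAt ℝ g p :=
    (hg.contDiffAt hUp).differentiableAt (by simp)
  have hda := differentiableAt_of_contDiffOn ha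
  have hdb := differentiableAt_of_contDiffOn hb
  have hdc := differentiableAt_of_contDiffOn hc
  have hdd := differentiableAt_of_contDiffOn hd
  have htrace : fderiv ℝ (fun q => a q + d q) p = ContinuousLinearMap.fst ℝ ℝ ℝ := by
    have heq : (fun q => a q + d q) =ᶠ[nhds p] Prod.fst := by
      filter_upwards [hUp] with q hq using htr q hq
    rw [heq.fderiv_eq, fderiv_fst]
  have hsum : fderiv ℝ a p + fderiv ℝ d p = ContinuousLinearMap.fst ℝ ℝ ℝ := by
    rw [← htrace, fderiv_fun_add hda hdd]
  have hsum_x : fderiv ℝ a p (1, 0) + fderiv ℝ d p (1, 0) = 1 := by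
    simpa using congrArg (fun L => L (1, 0)) hsum
  have hsum_y : fderiv ℝ a p (0, 1) + fderiv ℝ d p (0, 1) = 0 := by
    simpa using congrArg (fun L => L (0, 1)) hsum
  have hdet : fderiv ℝ (fun q => a q * d q - b q * c q) p =
      a p • fderiv ℝ d p + d p • fderiv ℝ a p - fderiv ℝ (fun q => b q * c q) p := by
    rw [fderiv_fun_sub (hda.fun_mul hdd) (hdb.fun_mul hdc), fderiv_fun_mul hda hdd]
  obtain ⟨hy, hx⟩ := hT p hp
  have hne := hfy p hp
  have htp := htr p hp
  simp only [pdx, pdy, htrace, ContinuousLinearMap.coe_fst'] at hx hy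
  have hfx : pdx (fun q => a q * d q - b q * c q) p = d p := by
    simp only [pdx, hdet, sub_apply, add_apply,
      smul_apply, smul_eq_mul]
    linear_combination hx + d p * hsum_x
  have hfb : pdy (fun q => a q * d q - b q * c q) p = -b p := by
    simp only [pdy, hdet, sub_apply, add_apply,
      smul_apply, smul_eq_mul]
    linear_combination -hy + a p * hsum_y
  rw [hfb] at hne
  have hb0 : b p ≠ 0 := neg_ne_zero.mp hne
  rw [hfx, hfb, ← htp, neg_neg]
  refine ⟨by ring, rfl, rfl, ?_⟩
  rw [eq_div_iff hb0]
  ring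
end

section
/- Let U ⊆ ℝ² be an open set and g a smooth function on U with ∂g/∂y(p) ≠ 0 for every p ∈ U. Define a = x/2 + ∂g/∂x, b = ∂g/∂y, c = −((∂g/∂x)² − g)/(∂g/∂y), d = x/2 − ∂g/∂x. Then (a,b,c,d) is a Nijenhuis operator on U with a+d = x and discriminant ((a+d)/2)² − (a·d − b·c) = g on U. -/
open Real Set

/-- `g` is an admissible discriminant (relative to its domain of definition `U`): there are an
open neighbourhood `V ⊆ U` of the origin and a Nijenhuis operator `(a,b,c,d)` on `V` with
trace `x` whose discriminant equals `g` on `V`. -/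
def AdmissibleDiscriminantOn (U : Set (ℝ × ℝ)) (g : ℝ × ℝ → ℝ) : Prop :=
  ∃ V : Set (ℝ × ℝ), V ⊆ U ∧ IsOpen V ∧ (0, 0) ∈ V ∧
    ∃ a b c d : ℝ × ℝ → ℝ, IsNijenhuisOn V a b c d ∧
      (∀ p ∈ V, a p + d p = p.1) ∧
      (∀ p ∈ V, ((a p + d p) / 2) ^ 2 - (a p * d p - b p * c p) = g p)

lemma contDiffOn_fderiv_apply_const {U : Set (ℝ × ℝ)} (hU : IsOpen U) {g : ℝ × ℝ → ℝ}
    (hg : ContDiffOn ℝ (⊤ : ℕ∞) g U) (v : ℝ × ℝ) :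
    ContDiffOn ℝ (⊤ : ℕ∞) (fun p => fderiv ℝ g p v) U :=
  (hg.fderiv_of_isOpen hU (by simp)).clm_apply contDiffOn_const

theorem stmt1 (U : Set (ℝ × ℝ)) (hU : IsOpen U) (g : ℝ × ℝ → ℝ)
    (hg : ContDiffOn ℝ (⊤ : ℕ∞) g U) (hgy : ∀ p ∈ U, pdy g p ≠ 0) :
    IsNijenhuisOn U
      (fun p => p.1 / 2 + pdx g p)
      (fun p => pdy g p)
      (fun p => -((pdx g p) ^ 2 - g p) / pdy g p)
      (fun p => p.1 / 2 - pdx g p) ∧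
    (∀ p ∈ U, (p.1 / 2 + pdx g p) + (p.1 / 2 - pdx g p) = p.1) ∧
    (∀ p ∈ U,
      (((p.1 / 2 + pdx g p) + (p.1 / 2 - pdx g p)) / 2) ^ 2 -
        ((p.1 / 2 + pdx g p) * (p.1 / 2 - pdx g p) -
          pdy g p * (-((pdx g p) ^ 2 - g p) / pdy g p)) = g p) := by
  have hx : ContDiffOn ℝ (⊤ : ℕ∞) (pdx g) U := contDiffOn_fderiv_apply_const hU hg _
  have hy : ContDiffOn ℝ (⊤ : ℕ∞) (pdy g) U := contDiffOn_fderiv_apply_const hU hg _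
  have hhalf : ContDiffOn ℝ (⊤ : ℕ∞) (fun p : ℝ × ℝ => p.1 / 2) U :=
    contDiffOn_fst.div_const 2
  refine ⟨⟨hhalf.add hx, hy, ((hx.pow 2).sub hg).neg.div hy hgy, hhalf.sub hx, ?_⟩,
    fun p _ => by ring, fun p hp => ?_⟩
  · intro p hp
    have hUp : U ∈ nhds p := hU.mem_nhds hp
    have hgp := ((hg.contDiffAt hUp).differentiableAt (by simp)).hasFDerivAt
    have hxp := ((hx.contDiffAt hUp).differentiableAt (by simp)).hasFDerivAt
    have hfst : HasFDerivAt (fun q : ℝ × ℝ => q.1) (ContinuousLinearMap.fst ℝ ℝ ℝ) p :=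
      hasFDerivAt_fst
    have hfst2 : HasFDerivAt (fun q : ℝ × ℝ => q.1 / 2)
        ((2 : ℝ)⁻¹ • ContinuousLinearMap.fst ℝ ℝ ℝ) p := by
      simpa only [div_eq_mul_inv] using hfst.mul_const (2 : ℝ)⁻¹
    have ha := (hfst2.add hxp).fderiv
    have hd := (hfst2.sub hxp).fderiv
    have htr : (fun q : ℝ × ℝ => (q.1 / 2 + pdx g q) + (q.1 / 2 - pdx g q)) = fun q => q.1 := by
      funext q; ring
    have hbc : (fun q => pdy g q * (-((pdx g q) ^ 2 - g q) / pdy g q)) =ᶠ[nhds p]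
        fun q => g q - pdx g q * pdx g q := by
      filter_upwards [hUp] with q hq
      field_simp [hgy q hq]
      ring
    have hbc' := hbc.fderiv_eq.trans (hgp.sub (hxp.mul hxp)).fderiv
    have hgx : fderiv ℝ g p (1, 0) = pdx g p := rfl
    have hgy' : fderiv ℝ g p (0, 1) = pdy g p := rfl
    have ha' : fderiv ℝ (fun q : ℝ × ℝ => q.1 / 2 + pdx g q) p = _ := ha
    have hd' : fderiv ℝ (fun q : ℝ × ℝ => q.1 / 2 - pdx g q) p = _ := hd
    have hp0 := hgy p hp
    simp only [htr]
    constructor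
    · change fderiv ℝ (fun q : ℝ × ℝ => q.1 / 2 + pdx g q) p (0, 1) * _ +
        fderiv ℝ _ p (0, 1) - fderiv ℝ _ p (1, 0) * _ = 0
      rw [ha', hbc', hfst.fderiv]
      simp [hgy']
      ring
    · change fderiv ℝ (fun q : ℝ × ℝ => q.1 / 2 - pdx g q) p (1, 0) * _ -
        fderiv ℝ _ p (1, 0) + fderiv ℝ _ p (0, 1) * _ = 0
      rw [hd', hbc', hfst.fderiv]
      simp [hgx]
      ring
  · have := hgy p hp
    field_simp
    ring
end

section
/- Let g be a smooth function on an open neighbourhood U of the origin in ℝ². Then g is an admissible discriminant if and only if there exist an open neighbourhood V ⊆ U of the origin and a smooth function h on V such that h · ∂g/∂y = (∂g/∂x)² − g everywhere on V. -/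
open Real Set

/-- For an operator with trace `x` and discriminant `g`, the two essential components of the
Nijenhuis torsion are `∂g/∂y - b` and `(a - d) / 2 - ∂g/∂x`. -/
theorem torsion_eq_of_trace_eq_fst {V : Set (ℝ × ℝ)} (hV : IsOpen V) {a b c d g : ℝ × ℝ → ℝ}
    (ha : ContDiffOn ℝ (⊤ : ℕ∞) a V) (hb : ContDiffOn ℝ (⊤ : ℕ∞) b V)
    (hc : ContDiffOn ℝ (⊤ : ℕ∞) c V) (hd : ContDiffOn ℝ (⊤ : ℕ∞) d V)
    (htr : ∀ p ∈ V, a p + d p = p.1)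
    (hdisc : ∀ p ∈ V, ((a p + d p) / 2) ^ 2 - (a p * d p - b p * c p) = g p)
    {p : ℝ × ℝ} (hp : p ∈ V) :
    pdy a p * (a p - d p) + pdy (fun q => b q * c q) p - pdx (fun q => a q + d q) p * b p
        = pdy g p - b p ∧
    pdx d p * (a p - d p) - pdx (fun q => b q * c q) p + pdy (fun q => a q + d q) p * c p
        = (a p - d p) / 2 - pdx g p := by
  have hVp : V ∈ nhds p := hV.mem_nhds hp
  have diffAt {f : ℝ × ℝ → ℝ} (hf : ContDiffOn ℝ (⊤ : ℕ∞) f V) : HasFDerivAt f (fderiv ℝ f p) p :=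
    ((hf.contDiffAt hVp).differentiableAt (by simp)).hasFDerivAt
  have hbc := diffAt (hb.mul hc)
  have hsum : HasFDerivAt (fun q => a q + d q) (ContinuousLinearMap.fst ℝ ℝ ℝ) p :=
    hasFDerivAt_fst.congr_of_eventuallyEq (Filter.eventually_of_mem hVp htr)
  have hsum' := hsum.unique ((diffAt ha).add (diffAt hd))
  have hg : HasFDerivAt g _ p :=
    (((hasFDerivAt_fst (𝕜 := ℝ) (p := p)).mul (hasFDerivAt_fst (𝕜 := ℝ) (p := p))).const_mul
      (1 / 4 : ℝ) |>.sub ((diffAt ha).mul (diffAt hd)) |>.add hbc).congr_of_eventuallyEq <| by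
      filter_upwards [hVp] with q hq
      have h := hdisc q hq
      rw [htr q hq] at h
      simp only [Pi.add_apply, Pi.sub_apply, Pi.mul_apply]
      linarith
  have hx := DFunLike.congr_fun hsum' (1, 0)
  have hy := DFunLike.congr_fun hsum' (0, 1)
  have hp1 := htr p hp
  simp only [pdx, pdy, hsum.fderiv, hg.fderiv]
  simp at hx hy ⊢
  rw [← hp1]
  constructor
  · linear_combination -a p * hy
  · linear_combination d p * hx

theorem stmt2 (U : Set (ℝ × ℝ)) (hU : IsOpen U) (hU0 : (0, 0) ∈ U)
    (g : ℝ × ℝ → ℝ) (hg : ContDiffOn ℝ (⊤ : ℕ∞) g U) :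
    AdmissibleDiscriminantOn U g ↔
      ∃ V : Set (ℝ × ℝ), V ⊆ U ∧ IsOpen V ∧ (0, 0) ∈ V ∧
        ∃ h : ℝ × ℝ → ℝ, ContDiffOn ℝ (⊤ : ℕ∞) h V ∧
          ∀ p ∈ V, h p * pdy g p = (pdx g p) ^ 2 - g p := by
  constructor
  · rintro ⟨V, hVU, hV, hV0, a, b, c, d, ⟨ha, hb, hc, hd, hN⟩, htr, hdisc⟩
    refine ⟨V, hVU, hV, hV0, fun p => -c p, hc.neg, fun p hp => ?_⟩
    obtain ⟨h₁, h₂⟩ := torsion_eq_of_trace_eq_fst hV ha hb hc hd htr hdisc hp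
    rw [(hN p hp).1] at h₁
    rw [(hN p hp).2] at h₂
    have hgy : pdy g p = b p := by linarith
    have hgx : pdx g p = (a p - d p) / 2 := by linarith
    rw [hgy, hgx, ← hdisc p hp]
    ring
  · rintro ⟨V, hVU, hV, hV0, h, hh, hgh⟩
    have hfderiv : ContDiffOn ℝ (⊤ : ℕ∞) (fderiv ℝ g) V :=
      (hg.mono hVU).fderiv_of_isOpen hV (by simp)
    have hgx : ContDiffOn ℝ (⊤ : ℕ∞) (pdx g) V := hfderiv.clm_apply contDiffOn_const
    have hgy : ContDiffOn ℝ (⊤ : ℕ∞) (pdy g) V := hfderiv.clm_apply contDiffOn_const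
    have hfst : ContDiffOn ℝ (⊤ : ℕ∞) (fun p : ℝ × ℝ => p.1 / 2) V :=
      contDiffOn_fst.div_const 2
    have htr : ∀ p ∈ V, (p.1 / 2 + pdx g p) + (p.1 / 2 - pdx g p) = p.1 := fun p _ => by ring
    have hdisc : ∀ p ∈ V, (((p.1 / 2 + pdx g p) + (p.1 / 2 - pdx g p)) / 2) ^ 2
        - ((p.1 / 2 + pdx g p) * (p.1 / 2 - pdx g p) - pdy g p * -h p) = g p := fun p hp => by
      linear_combination -hgh p hp
    refine ⟨V, hVU, hV, hV0, fun p => p.1 / 2 + pdx g p, pdy g, fun p => -h p,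
      fun p => p.1 / 2 - pdx g p,
      ⟨hfst.add hgx, hgy, hh.neg, hfst.sub hgx, fun p hp => ?_⟩, htr, hdisc⟩
    obtain ⟨h₁, h₂⟩ := torsion_eq_of_trace_eq_fst hV (hfst.add hgx) hgy hh.neg (hfst.sub hgx)
      htr hdisc hp
    exact ⟨h₁.trans (by ring), h₂.trans (by ring)⟩
end

section
/- Let U be a connected open neighbourhood of the origin in ℝ² and let (a,b,c,d) be a Nijenhuis operator on U with a(x,y)+d(x,y) = x on U, and suppose that the determinant a·d − b·c depends only on x, i.e. a·d − b·c = f(x) on U for a smooth function f of one variable. Then b ≡ 0 on U, and either there exists α ∈ ℝ such that d(x,y) = α, a(x,y) = x − α and f(x) = αx − α² on U, or d(x,y) = x/2, a(x,y) = x/2 and f(x) = x²/4 on U; the function c is not constrained. -/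
open Real Set

/-- A `C¹` function `d` with `(x - 2 d) • fderiv d = 0` on a preconnected open set is either constant
or equal to `x / 2`. -/
theorem eqOn_const_or_eqOn_half_fst {U : Set (ℝ × ℝ)} (hU : IsOpen U) (hUconn : IsPreconnected U)
    {d : ℝ × ℝ → ℝ} (hd : ContDiffOn ℝ 1 d U)
    (h : ∀ p ∈ U, (p.1 - 2 * d p) • fderiv ℝ d p = 0) :
    (∃ α : ℝ, ∀ p ∈ U, d p = α) ∨ ∀ p ∈ U, d p = p.1 / 2 := by
  have hcont : ContinuousOn (fderiv ℝ d) U := hd.continuousOn_fderiv_of_isOpen hU le_rfl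
  have hdiff : DifferentiableOn ℝ d U := hd.differentiableOn one_ne_zero
  set L : ℝ × ℝ →L[ℝ] ℝ := (1 / 2 : ℝ) • ContinuousLinearMap.fst ℝ ℝ ℝ with hL
  have hhalf : ∀ p ∈ U, fderiv ℝ d p ≠ 0 → d p = p.1 / 2 := fun p hp hne => by
    have := (smul_eq_zero.mp (h p hp)).resolve_right hne
    linarith
  have hvals : MapsTo (fderiv ℝ d) U {0, L} := by
    intro p hp
    by_cases hne : fderiv ℝ d p = 0
    · exact Or.inl hne
    · have hUp := hU.mem_nhds hp
      have hev : d =ᶠ[nhds p] L := by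
        filter_upwards [hUp, (hcont.continuousAt hUp).eventually_ne hne] with q hq hqne
        rw [hhalf q hq hqne]
        simp [hL]
        ring
      exact Or.inr (hev.fderiv_eq.trans L.fderiv)
  have hconst : ∀ p ∈ U, ∀ q ∈ U, fderiv ℝ d p = fderiv ℝ d q := fun p hp q hq =>
    hUconn.constant_of_mapsTo (toFinite _).isDiscrete hcont hvals hp hq
  by_cases hzero : ∀ p ∈ U, fderiv ℝ d p = 0
  · exact Or.inl (hU.exists_is_const_of_fderiv_eq_zero hUconn hdiff hzero)
  · push Not at hzero
    obtain ⟨p, hp, hne⟩ := hzero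
    exact Or.inr fun q hq => hhalf q hq (hconst p hp q hq ▸ hne)

theorem stmt3 (U : Set (ℝ × ℝ)) (hU : IsOpen U) (hUconn : IsConnected U)
    (hU0 : (0, 0) ∈ U) (a b c d : ℝ × ℝ → ℝ)
    (hN : IsNijenhuisOn U a b c d)
    (htr : ∀ p ∈ U, a p + d p = p.1)
    (f : ℝ → ℝ) (hf : ContDiff ℝ (⊤ : ℕ∞) f)
    (hdet : ∀ p ∈ U, a p * d p - b p * c p = f p.1) :
    (∀ p ∈ U, b p = 0) ∧
    ((∃ α : ℝ, ∀ p ∈ U, d p = α ∧ a p = p.1 - α ∧ f p.1 = α * p.1 - α ^ 2) ∨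
      (∀ p ∈ U, d p = p.1 / 2 ∧ a p = p.1 / 2 ∧ f p.1 = p.1 ^ 2 / 4)) := by
  obtain ⟨-, -, -, hd, hT⟩ := hN
  have hdd : ∀ p ∈ U, HasFDerivAt d (fderiv ℝ d p) p := fun p hp =>
    ((hd.differentiableOn (by simp)).differentiableAt (hU.mem_nhds hp)).hasFDerivAt
  have hda : ∀ p ∈ U, HasFDerivAt a (ContinuousLinearMap.fst ℝ ℝ ℝ - fderiv ℝ d p) p :=
    fun p hp => (hasFDerivAt_fst.sub (hdd p hp)).congr_of_eventuallyEq <| by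
      filter_upwards [hU.mem_nhds hp] with q hq
      simp [← htr q hq]
  have hdtr : ∀ p ∈ U, HasFDerivAt (fun q => a q + d q) (ContinuousLinearMap.fst ℝ ℝ ℝ) p :=
    fun p hp => hasFDerivAt_fst.congr_of_eventuallyEq <| by
      filter_upwards [hU.mem_nhds hp] with q hq using htr q hq
  have hdf : ∀ p : ℝ × ℝ, HasFDerivAt (fun q : ℝ × ℝ => f q.1)
      (deriv f p.1 • ContinuousLinearMap.fst ℝ ℝ ℝ) p := fun p =>
    (hf.differentiable (by simp) p.1).hasDerivAt.comp_hasFDerivAt p hasFDerivAt_fst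
  have hdbc : ∀ p ∈ U, HasFDerivAt (fun q => b q * c q)
      (a p • fderiv ℝ d p + d p • (ContinuousLinearMap.fst ℝ ℝ ℝ - fderiv ℝ d p) -
        deriv f p.1 • ContinuousLinearMap.fst ℝ ℝ ℝ) p :=
    fun p hp => (((hda p hp).mul (hdd p hp)).sub (hdf p)).congr_of_eventuallyEq <| by
      filter_upwards [hU.mem_nhds hp] with q hq
      simp [← hdet q hq]
  have hb : ∀ p ∈ U, b p = 0 := by
    intro p hp
    have h1 := (hT p hp).1
    simp only [pdx, pdy, (hda p hp).fderiv, (hdtr p hp).fderiv, (hdbc p hp).fderiv] at h1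
    simp at h1
    linarith
  have hbc0 : ∀ p ∈ U, fderiv ℝ (fun q => b q * c q) p = 0 := fun p hp => by
    have hev : (fun q => b q * c q) =ᶠ[nhds p] fun _ => (0 : ℝ) := by
      filter_upwards [hU.mem_nhds hp] with q hq
      simp [hb q hq]
    simp [hev.fderiv_eq]
  have hD : ∀ p ∈ U, (p.1 - 2 * d p) • fderiv ℝ d p = 0 := by
    intro p hp
    have h2 := (hT p hp).2
    simp only [pdx, pdy, (hdtr p hp).fderiv, hbc0 p hp] at h2
    have h3 := DFunLike.congr_fun ((hdbc p hp).fderiv.symm.trans (hbc0 p hp)) ((0, 1) : ℝ × ℝ)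
    have h4 := htr p hp
    simp at h2 h3
    ext
    · simp
      rcases h2 with h2 | h2
      · exact Or.inr h2
      · left; linarith
    · have : (p.1 - 2 * d p) * fderiv ℝ d p (0, 1) = 0 := by
        rw [← h4]; linarith
      simpa using this
  refine ⟨hb, ?_⟩
  have hfin : ∀ p ∈ U, a p = p.1 - d p ∧ f p.1 = (p.1 - d p) * d p := fun p hp => by
    have ha : a p = p.1 - d p := by linarith [htr p hp]
    exact ⟨ha, by rw [← hdet p hp, hb p hp, ha]; ring⟩
  rcases eqOn_const_or_eqOn_half_fst hU hUconn.isPreconnected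
    (hd.of_le (by exact_mod_cast le_top)) hD with ⟨α, hα⟩ | hx
  · refine Or.inl ⟨α, fun p hp => ?_⟩
    obtain ⟨h1, h2⟩ := hfin p hp
    rw [hα p hp] at h1 h2
    exact ⟨hα p hp, h1, by rw [h2]; ring⟩
  · refine Or.inr fun p hp => ?_
    obtain ⟨h1, h2⟩ := hfin p hp
    rw [hx p hp] at h1 h2
    exact ⟨hx p hp, by rw [h1]; ring, by rw [h2]; ring⟩
end

section
/- Let g : ℝ → ℝ be a smooth (infinitely differentiable) function satisfying g'(x)² = g(x) for all x ∈ ℝ. Then either g ≡ 0, or there exists α ∈ ℝ such that g(x) = (x/2 − α)² for all x ∈ ℝ. Equivalently, every smooth f : ℝ → ℝ satisfying (x − f'(x))·f'(x) = f(x) for all x is of the form f(x) = αx − α² for some α ∈ ℝ or f(x) = x²/4. -/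
open Real

/-- A differentiable function `h` with continuous derivative and `h * (2 * h' - 1) = 0` either
vanishes identically or is affine with slope `1 / 2`. -/
theorem eq_zero_or_eq_half_add_of_mul_deriv {h : ℝ → ℝ} (hd : Differentiable ℝ h)
    (hc : Continuous (deriv h)) (hh : ∀ x, h x * (2 * deriv h x - 1) = 0) :
    (∀ x, h x = 0) ∨ ∀ x, h x = x / 2 + h 0 := by
  have key (x : ℝ) (hx : deriv h x ≠ 1 / 2) : deriv h x = 0 := by
    have ev : h =ᶠ[nhds x] fun _ ↦ 0 := by
      filter_upwards [hc.continuousAt.eventually_ne hx] with y hy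
      refine (mul_eq_zero.mp (hh y)).resolve_right fun h0 ↦ hy ?_
      linarith
    rw [ev.deriv_eq, deriv_const]
  have clopen : IsClopen {x | deriv h x = 1 / 2} := by
    refine ⟨isClosed_eq hc continuous_const, ?_⟩
    have compl_eq : {x | deriv h x = 1 / 2} = {x | deriv h x = 0}ᶜ := by
      ext x
      refine ⟨fun hx h0 ↦ ?_, fun hx ↦ by_contra fun h0 ↦ hx (key x h0)⟩
      simp only [Set.mem_ofPred_eq] at hx h0
      linarith
    rw [compl_eq]
    exact (isClosed_eq hc continuous_const).isOpen_compl
  rcases isClopen_iff.mp clopen with hE | hU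
  · left
    intro x
    refine (mul_eq_zero.mp (hh x)).resolve_right fun h0 ↦ ?_
    have hx : x ∈ {x | deriv h x = 1 / 2} := by
      rw [Set.mem_ofPred_eq]
      linarith
    rw [hE] at hx
    exact hx.elim
  · right
    intro x
    have hderiv (y : ℝ) : HasDerivAt (fun z ↦ h z - z / 2) 0 y := by
      have hy : deriv h y = 1 / 2 := hU.ge (Set.mem_univ y)
      have hsub := (hd y).hasDerivAt.sub ((hasDerivAt_id y).div_const 2)
      rwa [hy, sub_self] at hsub
    have hconst := is_const_of_deriv_eq_zero (fun y ↦ (hderiv y).differentiableAt)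
      (fun y ↦ (hderiv y).deriv) x 0
    linarith

/-- The twice continuously differentiable solutions of `g' ^ 2 = g` on the real line. -/
theorem eq_zero_or_eq_sq_of_deriv_sq_eq {g : ℝ → ℝ} (hg : ContDiff ℝ 2 g)
    (h : ∀ x, deriv g x ^ 2 = g x) :
    (∀ x, g x = 0) ∨ ∃ α : ℝ, ∀ x, g x = (x / 2 - α) ^ 2 := by
  have hg' : ContDiff ℝ 1 (deriv g) := hg.deriv'
  have hd : Differentiable ℝ (deriv g) := hg'.differentiable one_ne_zero
  have hmul (x : ℝ) : deriv g x * (2 * deriv (deriv g) x - 1) = 0 := by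
    have h1 := ((hd x).hasDerivAt.pow 2).deriv
    have h2 : deriv g ^ 2 = g := funext h
    rw [h2] at h1
    norm_num at h1
    linarith
  rcases eq_zero_or_eq_half_add_of_mul_deriv hd (hg'.continuous_deriv le_rfl) hmul with h0 | h0
  · left
    intro x
    rw [← h, h0]
    norm_num
  · right
    refine ⟨-deriv g 0, fun x ↦ ?_⟩
    rw [← h, h0 x, sub_neg_eq_add]

theorem stmt4 :
    (∀ g : ℝ → ℝ, ContDiff ℝ (⊤ : ℕ∞) g → (∀ x, (deriv g x) ^ 2 = g x) →
      (∀ x, g x = 0) ∨ ∃ α : ℝ, ∀ x, g x = (x / 2 - α) ^ 2) ∧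
    (∀ f : ℝ → ℝ, ContDiff ℝ (⊤ : ℕ∞) f → (∀ x, (x - deriv f x) * deriv f x = f x) →
      (∃ α : ℝ, ∀ x, f x = α * x - α ^ 2) ∨ (∀ x, f x = x ^ 2 / 4)) := by
  have two_le : (2 : WithTop ℕ∞) ≤ ((⊤ : ℕ∞) : WithTop ℕ∞) := by
    exact WithTop.coe_le_coe.mpr (le_top : (2 : ℕ∞) ≤ ⊤)
  refine ⟨fun g hg h ↦ eq_zero_or_eq_sq_of_deriv_sq_eq (hg.of_le two_le) h, fun f hf h ↦ ?_⟩
  have hf2 : ContDiff ℝ 2 f := hf.of_le two_le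
  have hg : ContDiff ℝ 2 fun x ↦ x ^ 2 / 4 - f x := by fun_prop
  have hderiv (x : ℝ) : deriv (fun x ↦ x ^ 2 / 4 - f x) x = x / 2 - deriv f x := by
    have hfx := (hf2.differentiable two_ne_zero x).hasDerivAt
    refine ((((hasDerivAt_id x).pow 2).div_const 4).sub hfx).deriv.trans ?_
    simp only [id]
    ring
  have hsq (x : ℝ) : deriv (fun x ↦ x ^ 2 / 4 - f x) x ^ 2 = x ^ 2 / 4 - f x := by
    rw [hderiv]
    linear_combination -h x
  rcases eq_zero_or_eq_sq_of_deriv_sq_eq hg hsq with h0 | ⟨α, hα⟩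
  · right
    intro x
    linarith [h0 x]
  · left
    refine ⟨α, fun x ↦ ?_⟩
    linear_combination -hα x
end

section
/- Let g be a smooth function on a neighbourhood of the origin in ℝ² with g(0,0) = 0, ∂g/∂y(0,0) = 0 and ∂²g/∂y²(0,0) ≠ 0. Then g is an admissible discriminant if and only if there exist an open neighbourhood V of the origin, a sign ε ∈ {1,−1}, a number δ ∈ {0,1}, and a smooth function φ : V → ℝ with φ(0,0) = 0 and ∂φ/∂y(p) ≠ 0 for all p ∈ V, such that g(x,y) = ε·φ(x,y)² + δ·x²/4 on V. -/
open Real Set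

section Calculus

open Filter Topology ContDiff intervalIntegral

/-- Smoothness of an integral over `[0, 1]` depending smoothly on a parameter. -/
theorem contDiff_nat_intervalIntegral {E : Type} [NormedAddCommGroup E] [NormedSpace ℝ E]
    [ProperSpace E] (n : ℕ) :
    ∀ {F : Type} [NormedAddCommGroup F] [NormedSpace ℝ F] {f : E × ℝ → F}, ContDiff ℝ ∞ f →
      ContDiff ℝ n (fun p => ∫ t in (0 : ℝ)..1, f (p, t)) := by
  induction n with
  | zero =>
    intro F _ _ f hf
    have hc : Continuous (Function.uncurry fun (p : E) (t : ℝ) => f (p, t)) := hf.continuous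
    exact contDiff_zero.2 (continuous_parametric_intervalIntegral_of_continuous' hc 0 1)
  | succ n ih =>
    intro F _ _ f hf
    have hL : ContDiff ℝ ∞ fun q : E × ℝ =>
        (fderiv ℝ f q).comp (ContinuousLinearMap.inl ℝ E ℝ) :=
      (hf.fderiv_right (m := ∞) (by simp)).clm_comp contDiff_const
    have hd (x : E) (t : ℝ) : HasFDerivAt (fun x => f (x, t))
        ((fderiv ℝ f (x, t)).comp (ContinuousLinearMap.inl ℝ E ℝ)) x :=
      (hf.differentiable (by simp) (x, t)).hasFDerivAt.comp x (hasFDerivAt_prodMk_left x t)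
    rw [Nat.cast_succ, contDiff_succ_iff_hasFDerivAt]
    refine ⟨_, ih hL, fun x => ?_⟩
    obtain ⟨C, hC⟩ := ((isCompact_closedBall x 1).prod
      (isCompact_Icc (a := (0 : ℝ)) (b := 1))).exists_bound_of_continuousOn
      hL.continuous.continuousOn
    have hm (x : E) : Continuous fun t : ℝ => f (x, t) := hf.continuous.comp (by fun_prop)
    refine hasFDerivAt_integral_of_dominated_of_fderiv_le
      (F' := fun x t => (fderiv ℝ f (x, t)).comp (ContinuousLinearMap.inl ℝ E ℝ))
      (bound := fun _ => C) (Metric.closedBall_mem_nhds x one_pos)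
      (.of_forall fun y => (hm y).aestronglyMeasurable) ((hm x).intervalIntegrable _ _)
      (hL.continuous.comp (by fun_prop : Continuous fun t : ℝ => (x, t))).aestronglyMeasurable
      (.of_forall fun t ht y hy => hC (y, t) ⟨hy, ?_⟩) intervalIntegrable_const
      (.of_forall fun t _ y _ => hd y t)
    rw [Set.uIoc_of_le zero_le_one] at ht
    exact Set.Ioc_subset_Icc_self ht

theorem contDiff_infty_intervalIntegral {E F : Type} [NormedAddCommGroup E] [NormedSpace ℝ E]
    [ProperSpace E] [NormedAddCommGroup F] [NormedSpace ℝ F] {f : E × ℝ → F}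
    (hf : ContDiff ℝ ∞ f) : ContDiff ℝ ∞ (fun p => ∫ t in (0 : ℝ)..1, f (p, t)) :=
  contDiff_infty.2 fun n => contDiff_nat_intervalIntegral n hf

theorem contDiff_pdx {G : ℝ × ℝ → ℝ} (hG : ContDiff ℝ ∞ G) : ContDiff ℝ ∞ (pdx G) :=
  (hG.fderiv_right (m := ∞) (by simp)).clm_apply contDiff_const

theorem contDiff_pdy {G : ℝ × ℝ → ℝ} (hG : ContDiff ℝ ∞ G) : ContDiff ℝ ∞ (pdy G) :=
  (hG.fderiv_right (m := ∞) (by simp)).clm_apply contDiff_const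

theorem contDiffOn_pdx {g : ℝ × ℝ → ℝ} {V : Set (ℝ × ℝ)} (hV : IsOpen V)
    (hg : ContDiffOn ℝ ∞ g V) : ContDiffOn ℝ ∞ (pdx g) V :=
  (hg.fderiv_of_isOpen (m := ∞) hV (by simp)).clm_apply contDiffOn_const

theorem contDiffOn_pdy {g : ℝ × ℝ → ℝ} {V : Set (ℝ × ℝ)} (hV : IsOpen V)
    (hg : ContDiffOn ℝ ∞ g V) : ContDiffOn ℝ ∞ (pdy g) V :=
  (hg.fderiv_of_isOpen (m := ∞) hV (by simp)).clm_apply contDiffOn_const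

theorem hasDerivAt_comp_curve {g : ℝ × ℝ → ℝ} {u v : ℝ → ℝ} {u' v' t : ℝ}
    (hg : DifferentiableAt ℝ g (u t, v t)) (hu : HasDerivAt u u' t) (hv : HasDerivAt v v' t) :
    HasDerivAt (fun t => g (u t, v t)) (u' * pdx g (u t, v t) + v' * pdy g (u t, v t)) t := by
  have h := hg.hasFDerivAt.comp_hasDerivAt t (hu.prodMk hv)
  convert! h using 1
  have : (u', v') = u' • ((1 : ℝ), (0 : ℝ)) + v' • ((0 : ℝ), (1 : ℝ)) := by simp
  rw [this, map_add, map_smul, map_smul]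
  rfl

/-- Second-order Taylor expansion in the second variable with smooth remainder. -/
theorem exists_contDiff_taylor_snd {G : ℝ × ℝ → ℝ} (hG : ContDiff ℝ ∞ G) :
    ∃ H : ℝ × ℝ × ℝ → ℝ, ContDiff ℝ ∞ H ∧
      (∀ x y z, G (x, y) = G (x, z) + pdy G (x, z) * (y - z) + (y - z) ^ 2 * H (x, y, z)) ∧
      ∀ x z, H (x, z, z) = pdy (pdy G) (x, z) / 2 := by
  have hG1 := contDiff_pdy hG
  have hG2 := contDiff_pdy hG1
  refine ⟨fun p => ∫ t in (0 : ℝ)..1,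
    (1 - t) * pdy (pdy G) (p.1, p.2.2 + t * (p.2.1 - p.2.2)), ?_, fun x y z => ?_, fun x z => ?_⟩
  · refine contDiff_infty_intervalIntegral (f := fun q : (ℝ × ℝ × ℝ) × ℝ =>
      (1 - q.2) * pdy (pdy G) (q.1.1, q.1.2.2 + q.2 * (q.1.2.1 - q.1.2.2))) ?_
    exact (contDiff_const.sub contDiff_snd).mul (hG2.comp (by fun_prop))
  · have hz (t : ℝ) : HasDerivAt (fun t => z + t * (y - z)) (y - z) t := by
      simpa using ((hasDerivAt_id t).mul_const (y - z)).const_add z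
    have hd (t : ℝ) : HasDerivAt (fun t => (1 - t) * (y - z) * pdy G (x, z + t * (y - z)) +
        G (x, z + t * (y - z)))
        ((y - z) ^ 2 * ((1 - t) * pdy (pdy G) (x, z + t * (y - z)))) t := by
      have e1 := hasDerivAt_comp_curve (hG.differentiable (by simp) _) (hasDerivAt_const t x) (hz t)
      have e2 := hasDerivAt_comp_curve (hG1.differentiable (by simp) _)
        (hasDerivAt_const t x) (hz t)
      convert! ((((hasDerivAt_id t).const_sub 1).mul_const (y - z)).mul e2).add e1 using 1
      simp only [id]
      ring
    have hi := integral_eq_sub_of_hasDerivAt (a := 0) (b := 1) (fun t _ => hd t)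
      (Continuous.intervalIntegrable
        (continuous_const.mul ((continuous_const.sub continuous_id).mul
          (hG2.continuous.comp (by fun_prop)))) _ _)
    rw [integral_const_mul] at hi
    dsimp only
    rw [hi]
    ring_nf
  · have : ∫ t in (0 : ℝ)..1, (1 - t) = 1 / 2 := by
      rw [integral_sub (by simp) (by simp), integral_const, integral_id]
      norm_num
    simp only [sub_self, mul_zero, add_zero]
    rw [integral_mul_const, this]
    ring

/-- A smooth function on an open set agrees near a point with a globally smooth one. -/
theorem exists_contDiff_eventuallyEq {E : Type*} [NormedAddCommGroup E] [NormedSpace ℝ E]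
    [FiniteDimensional ℝ E] {U : Set E} (hU : IsOpen U) {p : E} (hp : p ∈ U) {g : E → ℝ}
    (hg : ContDiffOn ℝ ∞ g U) : ∃ G : E → ℝ, ContDiff ℝ ∞ G ∧ G =ᶠ[𝓝 p] g := by
  obtain ⟨r, hr, hrU⟩ := Metric.nhds_basis_closedBall.mem_iff.1 (hU.mem_nhds hp)
  let χ : ContDiffBump p := ⟨r / 2, r, half_pos hr, half_lt_self hr⟩
  refine ⟨fun q => χ q * g q, contDiff_iff_contDiffAt.2 fun q => ?_, ?_⟩
  · by_cases hq : q ∈ U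
    · exact χ.contDiffAt.mul (hg.contDiffAt (hU.mem_nhds hq))
    · have hq' : q ∉ tsupport χ := fun h => hq (hrU (by rwa [χ.tsupport_eq] at h))
      refine (contDiffAt_const (c := (0 : ℝ))).congr_of_eventuallyEq ?_
      filter_upwards [notMem_tsupport_iff_eventuallyEq.1 hq'] with z hz
      simp [hz]
  · filter_upwards [χ.eventuallyEq_one] with q hq
    simp [hq]

/-- The shear `(u, v) ↦ (u, α u + β v)` as a continuous linear equivalence. -/
noncomputable def shearEquiv (α : ℝ) {β : ℝ} (hβ : β ≠ 0) : (ℝ × ℝ) ≃L[ℝ] (ℝ × ℝ) :=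
  ContinuousLinearEquiv.equivOfInverse
    ((ContinuousLinearMap.fst ℝ ℝ ℝ).prod
      (α • ContinuousLinearMap.fst ℝ ℝ ℝ + β • ContinuousLinearMap.snd ℝ ℝ ℝ))
    ((ContinuousLinearMap.fst ℝ ℝ ℝ).prod
      ((-(α / β)) • ContinuousLinearMap.fst ℝ ℝ ℝ + β⁻¹ • ContinuousLinearMap.snd ℝ ℝ ℝ))
    (fun p => by ext <;> simp; field_simp; ring)
    (fun p => by ext <;> simp; field_simp; ring)

theorem hasFDerivAt_fst_prod {k : ℝ × ℝ → ℝ} {p : ℝ × ℝ} (hk : DifferentiableAt ℝ k p)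
    (h : pdy k p ≠ 0) :
    HasFDerivAt (fun q => (q.1, k q)) (shearEquiv (pdx k p) h : (ℝ × ℝ) →L[ℝ] (ℝ × ℝ)) p := by
  convert! hasFDerivAt_fst.prodMk hk.hasFDerivAt using 1
  ext <;> simp [shearEquiv, pdx, pdy]

/-- Smooth implicit function theorem in the plane. -/
theorem exists_contDiffOn_implicit {k : ℝ × ℝ → ℝ} (hk : ContDiff ℝ ∞ k) (hk0 : k (0, 0) = 0)
    (hk1 : pdy k (0, 0) ≠ 0) :
    ∃ r > 0, ∃ s : ℝ → ℝ, ContDiffOn ℝ ∞ s (Ioo (-r) r) ∧ s 0 = 0 ∧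
      ∀ x ∈ Ioo (-r) r, k (x, s x) = 0 := by
  have hF : ContDiff ℝ ∞ fun q : ℝ × ℝ => (q.1, k q) := contDiff_fst.prodMk hk
  have hd := hk.differentiable (by simp)
  have hF0 := hasFDerivAt_fst_prod (hd (0, 0)) hk1
  let e := (hF.contDiffAt (x := ((0 : ℝ), (0 : ℝ)))).toOpenPartialHomeomorph _ hF0 (by simp)
  have he (q) : e q = (q.1, k q) := rfl
  have hs0 : (0, 0) ∈ e.source := ContDiffAt.mem_toOpenPartialHomeomorph_source _ hF0 _
  have ht0 : (0, 0) ∈ e.target := by simpa [he, hk0] using e.map_source hs0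
  have hsymm0 : e.symm (0, 0) = (0, 0) := by simpa [he, hk0] using e.left_inv hs0
  have hnear : ∀ᶠ x : ℝ in 𝓝 0, (x, (0 : ℝ)) ∈ e.target ∧ pdy k (e.symm (x, 0)) ≠ 0 := by
    have hi : Tendsto (fun x : ℝ => (x, (0 : ℝ))) (𝓝 0) (𝓝 (0, 0)) :=
      (by fun_prop : Continuous fun x : ℝ => (x, (0 : ℝ))).tendsto 0
    refine (hi.eventually (e.open_target.mem_nhds ht0)).and (hi.eventually (p := fun q => pdy k (e.symm q) ≠ 0) ?_)
    have hc : ContinuousAt (fun q => pdy k (e.symm q)) (0, 0) :=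
      (contDiff_pdy hk).continuous.continuousAt.comp (e.continuousAt_symm ht0)
    exact hc.eventually_ne (by rwa [hsymm0])
  obtain ⟨r, hr, hball⟩ := Metric.eventually_nhds_iff_ball.1 hnear
  rw [Real.ball_eq_Ioo, zero_sub, zero_add] at hball
  refine ⟨r, hr, fun x => (e.symm (x, 0)).2, fun x hx => ?_, by simp [hsymm0], fun x hx => ?_⟩
  · obtain ⟨hxt, hx1⟩ := hball x hx
    have h := e.contDiffAt_symm hxt (hasFDerivAt_fst_prod (hd _) hx1) hF.contDiffAt
    exact (contDiffAt_snd.comp x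
      (h.comp x (contDiffAt_id.prodMk contDiffAt_const))).contDiffWithinAt
  · have h := e.right_inv (hball x hx).1
    rw [he, Prod.mk.injEq] at h
    have hx' : (x, (e.symm (x, 0)).2) = e.symm (x, 0) := Prod.ext h.1.symm rfl
    simpa only [hx'] using h.2

/-- Smooth solutions of `(R')² = R` with `R 0 = 0` are `0` and `x² / 4`. -/
theorem eq_sq_div_four_of_deriv_sq_eq {r : ℝ} (hr : 0 < r) {R q : ℝ → ℝ}
    (hq : ContDiffOn ℝ ∞ q (Ioo (-r) r)) (hR : ∀ x ∈ Ioo (-r) r, HasDerivAt R (q x) x)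
    (hRq : ∀ x ∈ Ioo (-r) r, R x = q x ^ 2) (hR0 : R 0 = 0) :
    ∃ δ : ℝ, (δ = 0 ∨ δ = 1) ∧ ∀ x ∈ Ioo (-r) r, R x = δ * x ^ 2 / 4 := by
  have h0 : (0 : ℝ) ∈ Ioo (-r) r := ⟨by linarith, hr⟩
  have hqd : ∀ x ∈ Ioo (-r) r, HasDerivAt q (deriv q x) x := fun x hx =>
    ((hq.contDiffAt (isOpen_Ioo.mem_nhds hx)).differentiableAt (by simp)).hasDerivAt
  have hcont : ContinuousOn (deriv q) (Ioo (-r) r) :=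
    hq.continuousOn_deriv_of_isOpen isOpen_Ioo (by simp)
  have hhalf : ∀ x ∈ Ioo (-r) r, q x ≠ 0 → deriv q x = 1 / 2 := by
    intro x hx hne
    have h1 : HasDerivAt R (2 * q x * deriv q x) x := by
      have := (hqd x hx).pow 2
      refine HasDerivAt.congr_of_eventuallyEq (f := fun x => q x ^ 2)
        (by convert! this using 1; simp) ?_
      filter_upwards [isOpen_Ioo.mem_nhds hx] with y hy using hRq y hy
    have h2 := (hR x hx).unique h1
    have h3 : q x * (deriv q x - 1 / 2) = 0 := by linarith
    have := (mul_eq_zero.1 h3).resolve_left hne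
    linarith
  have hvals : ∀ x ∈ Ioo (-r) r, deriv q x = 0 ∨ deriv q x = 1 / 2 := by
    intro x hx
    by_cases hne : q x = 0
    · refine or_iff_not_imp_left.2 fun hd => ?_
      have hev : ∀ᶠ y in 𝓝[≠] x, deriv q y = 1 / 2 := by
        filter_upwards [(hqd x hx).eventually_ne (c := 0) hd,
          nhdsWithin_le_nhds (isOpen_Ioo.mem_nhds hx)] with y hy hy'
        exact hhalf y hy' hy
      have hlim := ((hcont.continuousAt (isOpen_Ioo.mem_nhds hx)).tendsto).mono_left
        (nhdsWithin_le_nhds (s := {x}ᶜ))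
      exact tendsto_nhds_unique (hlim.congr' hev) tendsto_const_nhds |>.symm ▸ rfl
    · exact .inr (hhalf x hx hne)
  have hconst : ∀ x ∈ Ioo (-r) r, deriv q x = deriv q 0 := by
    intro x hx
    by_contra hne
    have hmem : (1 / 4 : ℝ) ∈ deriv q '' Ioo (-r) r := by
      have himg := (isPreconnected_Ioo.image _ hcont).ordConnected
      rcases hvals x hx with h | h <;> rcases hvals 0 h0 with h' | h'
      · exact absurd (h.trans h'.symm) hne
      · exact himg.out ⟨x, hx, h⟩ ⟨0, h0, h'⟩ ⟨by norm_num, by norm_num⟩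
      · exact himg.out ⟨0, h0, h'⟩ ⟨x, hx, h⟩ ⟨by norm_num, by norm_num⟩
      · exact absurd (h.trans h'.symm) hne
    obtain ⟨y, hy, hy'⟩ := hmem
    rcases hvals y hy with h | h <;> rw [h] at hy' <;> norm_num at hy'
  have hq0 : q 0 = 0 := by simpa [hR0] using (hRq 0 h0).symm
  have hlin : ∀ x ∈ Ioo (-r) r, q x = deriv q 0 * x := by
    intro x hx
    have hdiff : ∀ y ∈ Ioo (-r) r, HasDerivAt (fun y => q y - deriv q 0 * y) 0 y := by
      intro y hy
      convert! (hqd y hy).sub ((hasDerivAt_id y).const_mul (deriv q 0)) using 1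
      rw [hconst y hy]
      simp
    have := isOpen_Ioo.is_const_of_deriv_eq_zero isPreconnected_Ioo
      (fun y hy => (hdiff y hy).differentiableAt.differentiableWithinAt)
      (fun y hy => (hdiff y hy).deriv) hx h0
    simp only [hq0, mul_zero, sub_zero] at this
    linarith
  rcases hvals 0 h0 with h | h
  · exact ⟨0, .inl rfl, fun x hx => by rw [hRq x hx, hlin x hx, h]; ring⟩
  · exact ⟨1, .inr rfl, fun x hx => by rw [hRq x hx, hlin x hx, h]; ring⟩

end Calculus

section Nijenhuis

open Filter Topology ContDiff

theorem HasFDerivAt.pdx_eq {f : ℝ × ℝ → ℝ} {f' : ℝ × ℝ →L[ℝ] ℝ} {p : ℝ × ℝ}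
    (h : HasFDerivAt f f' p) : pdx f p = f' (1, 0) := by
  rw [pdx, h.fderiv]

theorem HasFDerivAt.pdy_eq {f : ℝ × ℝ → ℝ} {f' : ℝ × ℝ →L[ℝ] ℝ} {p : ℝ × ℝ}
    (h : HasFDerivAt f f' p) : pdy f p = f' (0, 1) := by
  rw [pdy, h.fderiv]

theorem Filter.EventuallyEq.pdx_eq {f g : ℝ × ℝ → ℝ} {p : ℝ × ℝ} (h : f =ᶠ[𝓝 p] g) :
    pdx f p = pdx g p := by
  rw [pdx, pdx, h.fderiv_eq]

theorem Filter.EventuallyEq.pdy_eq {f g : ℝ × ℝ → ℝ} {p : ℝ × ℝ} (h : f =ᶠ[𝓝 p] g) :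
    pdy f p = pdy g p := by
  rw [pdy, pdy, h.fderiv_eq]

theorem Filter.EventuallyEq.pdy_eventuallyEq {f g : ℝ × ℝ → ℝ} {p : ℝ × ℝ} (h : f =ᶠ[𝓝 p] g) :
    pdy f =ᶠ[𝓝 p] pdy g := by
  filter_upwards [eventually_eventuallyEq_nhds.2 h] with q hq using hq.pdy_eq

/-- A Nijenhuis operator with trace `x` and discriminant `g` satisfies `c g_y = g - g_x ^ 2`. -/
theorem IsNijenhuisOn.mul_pdy_eq {V : Set (ℝ × ℝ)} (hV : IsOpen V) {a b c d g : ℝ × ℝ → ℝ}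
    (h : IsNijenhuisOn V a b c d) (ht : ∀ p ∈ V, a p + d p = p.1)
    (hdisc : ∀ p ∈ V, ((a p + d p) / 2) ^ 2 - (a p * d p - b p * c p) = g p)
    {p : ℝ × ℝ} (hp : p ∈ V) : c p * pdy g p = g p - pdx g p ^ 2 := by
  obtain ⟨ha, hb, hc, hd, heq⟩ := h
  have diff {f : ℝ × ℝ → ℝ} (hf : ContDiffOn ℝ ∞ f V) : HasFDerivAt f (fderiv ℝ f p) p :=
    ((hf.contDiffAt (hV.mem_nhds hp)).differentiableAt (by simp)).hasFDerivAt
  have hsum : (fun q => a q + d q) =ᶠ[𝓝 p] Prod.fst := by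
    filter_upwards [hV.mem_nhds hp] with q hq using ht q hq
  have hgev : g =ᶠ[𝓝 p] fun q => ((a q - d q) / 2) ^ 2 + b q * c q := by
    filter_upwards [hV.mem_nhds hp] with q hq
    rw [← hdisc q hq]
    ring
  have htr := (diff ha).add (diff hd)
  have hbc := (diff hb).mul (diff hc)
  have hg := ((((diff ha).sub (diff hd)).mul_const (1 / 2)).pow 2).add hbc
  have hg' : HasFDerivAt g _ p := hg.congr_of_eventuallyEq (by
    filter_upwards [hgev] with q hq
    simp [hq]; ring)
  have hsx : pdx a p + pdx d p = 1 := by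
    have := htr.pdx_eq.symm.trans (hsum.pdx_eq.trans hasFDerivAt_fst.pdx_eq)
    simpa [pdx] using this
  have hsy : pdy a p + pdy d p = 0 := by
    have := htr.pdy_eq.symm.trans (hsum.pdy_eq.trans hasFDerivAt_fst.pdy_eq)
    simpa [pdy] using this
  have hbcx := hbc.pdx_eq
  have hbcy := hbc.pdy_eq
  have hgx : pdx g p = (a p - d p) / 2 * (pdx a p - pdx d p) + pdx (fun q => b q * c q) p := by
    rw [hg'.pdx_eq]
    erw [hbcx]
    simp [pdx]
    ring
  have hgy : pdy g p = (a p - d p) / 2 * (pdy a p - pdy d p) + pdy (fun q => b q * c q) p := by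
    rw [hg'.pdy_eq]
    erw [hbcy]
    simp [pdy]
    ring
  obtain ⟨e1, e2⟩ := heq p hp
  rw [hsum.pdx_eq, hasFDerivAt_fst.pdx_eq] at e1
  rw [hsum.pdy_eq, hasFDerivAt_fst.pdy_eq] at e2
  simp only [ContinuousLinearMap.coe_fst', one_mul, zero_mul, add_zero] at e1 e2
  have hb' : pdy g p = b p := by
    rw [hgy, eq_neg_of_add_eq_zero_right hsy]
    linear_combination e1
  have hh : pdx g p = (a p - d p) / 2 := by
    rw [hgx, eq_sub_of_add_eq hsx]
    linear_combination -e2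
  rw [hb', hh, ← hdisc p hp]
  ring

/-- A smooth solution `c` of `c g_y = g - g_x ^ 2` gives a Nijenhuis operator. -/
theorem isNijenhuisOn_of_mul_pdy_eq {V : Set (ℝ × ℝ)} (hV : IsOpen V) {g c : ℝ × ℝ → ℝ}
    (hg : ContDiffOn ℝ ∞ g V) (hc : ContDiffOn ℝ ∞ c V)
    (h : ∀ p ∈ V, c p * pdy g p = g p - pdx g p ^ 2) :
    IsNijenhuisOn V (fun p => p.1 / 2 + pdx g p) (pdy g) c (fun p => p.1 / 2 - pdx g p) := by
  have hgx := contDiffOn_pdx hV hg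
  have hgy := contDiffOn_pdy hV hg
  have hx : ContDiffOn ℝ ∞ (fun p : ℝ × ℝ => p.1 / 2) V := by fun_prop
  refine ⟨hx.add hgx, hgy, hc, hx.sub hgx, fun p hp => ?_⟩
  have diff {f : ℝ × ℝ → ℝ} (hf : ContDiffOn ℝ ∞ f V) : HasFDerivAt f (fderiv ℝ f p) p :=
    ((hf.contDiffAt (hV.mem_nhds hp)).differentiableAt (by simp)).hasFDerivAt
  have hhalf : HasFDerivAt (fun q : ℝ × ℝ => q.1 / 2)
      ((1 / 2 : ℝ) • ContinuousLinearMap.fst ℝ ℝ ℝ) p := by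
    convert! (hasFDerivAt_fst (𝕜 := ℝ) (p := p)).const_mul (1 / 2 : ℝ) using 1
    ext q
    ring
  have ha := hhalf.add (diff hgx)
  have hd := hhalf.sub (diff hgx)
  have hbc : (fun q => pdy g q * c q) =ᶠ[𝓝 p] fun q => g q - pdx g q ^ 2 := by
    filter_upwards [hV.mem_nhds hp] with q hq
    rw [← h q hq, mul_comm]
  have hbc' := (diff hg).sub ((diff hgx).pow 2)
  have hs : (fun q : ℝ × ℝ => q.1 / 2 + pdx g q + (q.1 / 2 - pdx g q)) = Prod.fst := by
    ext q
    ring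
  have e1 : pdy (fun q => g q - pdx g q ^ 2) p = pdy g p - 2 * pdx g p * pdy (pdx g) p := by
    refine hbc'.pdy_eq.trans ?_
    simp [pdy]
  have e2 : pdx (fun q => g q - pdx g q ^ 2) p = pdx g p - 2 * pdx g p * pdx (pdx g) p := by
    refine hbc'.pdx_eq.trans ?_
    simp [pdx]
  have e3 : pdy (fun q => q.1 / 2 + pdx g q) p = pdy (pdx g) p := by
    refine ha.pdy_eq.trans ?_
    simp [pdy]
  have e4 : pdx (fun q => q.1 / 2 - pdx g q) p = 1 / 2 - pdx (pdx g) p := by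
    refine hd.pdx_eq.trans ?_
    simp [pdx]
  rw [hbc.pdx_eq, hbc.pdy_eq, hs, hasFDerivAt_fst.pdx_eq, hasFDerivAt_fst.pdy_eq, e1, e2, e3, e4]
  simp only [ContinuousLinearMap.coe_fst']
  constructor <;> ring

theorem admissibleDiscriminantOn_of_normalForm {U V : Set (ℝ × ℝ)} (hVU : V ⊆ U) (hV : IsOpen V)
    (hV0 : (0, 0) ∈ V) {g φ : ℝ × ℝ → ℝ} (hg : ContDiffOn ℝ ∞ g V) {ε δ : ℝ}
    (hε : ε = 1 ∨ ε = -1) (hδ : δ = 0 ∨ δ = 1) (hφ : ContDiffOn ℝ ∞ φ V)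
    (hφy : ∀ p ∈ V, pdy φ p ≠ 0) (hgφ : ∀ p ∈ V, g p = ε * φ p ^ 2 + δ * p.1 ^ 2 / 4) :
    AdmissibleDiscriminantOn U g := by
  have hφ1 := contDiffOn_pdx hV hφ
  have hφ2 := contDiffOn_pdy hV hφ
  let c : ℝ × ℝ → ℝ := fun p =>
    (φ p - 4 * ε * φ p * pdx φ p ^ 2 - 2 * δ * pdx φ p * p.1) / (2 * pdy φ p)
  have hc : ContDiffOn ℝ ∞ c V := by
    refine ContDiffOn.div ?_ (contDiffOn_const.mul hφ2)
      fun p hp => mul_ne_zero two_ne_zero (hφy p hp)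
    exact (hφ.sub ((contDiffOn_const.mul hφ).mul (hφ1.pow 2))).sub
      ((contDiffOn_const.mul hφ1).mul contDiffOn_fst)
  have key : ∀ p ∈ V, c p * pdy g p = g p - pdx g p ^ 2 := by
    intro p hp
    have hd : HasFDerivAt φ (fderiv ℝ φ p) p :=
      ((hφ.contDiffAt (hV.mem_nhds hp)).differentiableAt (by simp)).hasFDerivAt
    have hgev : g =ᶠ[𝓝 p] fun q => ε * φ q ^ 2 + δ / 4 * q.1 ^ 2 := by
      filter_upwards [hV.mem_nhds hp] with q hq
      rw [hgφ q hq]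
      ring
    have hd' := ((hd.pow 2).const_mul ε).add
      (((hasFDerivAt_fst (𝕜 := ℝ) (p := p)).pow 2).const_mul (δ / 4))
    have e1 : pdx g p = 2 * ε * φ p * pdx φ p + δ * p.1 / 2 := by
      refine hgev.pdx_eq.trans (hd'.pdx_eq.trans ?_)
      simp [pdx]
      ring
    have e2 : pdy g p = 2 * ε * φ p * pdy φ p := by
      refine hgev.pdy_eq.trans (hd'.pdy_eq.trans ?_)
      simp [pdy]
      ring
    have hne := hφy p hp
    rw [e1, e2, hgφ p hp]
    simp only [c]
    field_simp
    rcases hε with rfl | rfl <;> rcases hδ with rfl | rfl <;> ring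
  exact ⟨V, hVU, hV, hV0, _, _, c, _, isNijenhuisOn_of_mul_pdy_eq hV hg hc key,
    fun p _ => by ring, fun p hp => by rw [mul_comm (pdy g p), key p hp]; ring⟩

theorem AdmissibleDiscriminantOn.exists_normalForm {U : Set (ℝ × ℝ)} (hU : IsOpen U)
    (hU0 : (0, 0) ∈ U) {g : ℝ × ℝ → ℝ} (hg : ContDiffOn ℝ ∞ g U) (h0 : g (0, 0) = 0)
    (h1 : pdy g (0, 0) = 0) (h2 : pdy (pdy g) (0, 0) ≠ 0) (h : AdmissibleDiscriminantOn U g) :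
    ∃ V : Set (ℝ × ℝ), V ⊆ U ∧ IsOpen V ∧ (0, 0) ∈ V ∧
      ∃ ε : ℝ, (ε = 1 ∨ ε = -1) ∧
        ∃ δ : ℝ, (δ = 0 ∨ δ = 1) ∧
          ∃ φ : ℝ × ℝ → ℝ, ContDiffOn ℝ ∞ φ V ∧ φ (0, 0) = 0 ∧
            (∀ p ∈ V, pdy φ p ≠ 0) ∧ (∀ p ∈ V, g p = ε * (φ p) ^ 2 + δ * p.1 ^ 2 / 4) := by
  obtain ⟨V, hVU, hV, hV0, a, b, c, d, hN, htr, hdisc⟩ := h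
  obtain ⟨G, hG, hGg⟩ := exists_contDiff_eventuallyEq hU hU0 hg
  have hG0 : G (0, 0) = 0 := hGg.self_of_nhds.trans h0
  have hG1 : pdy G (0, 0) = 0 := hGg.pdy_eq.trans h1
  have hG2 : pdy (pdy G) (0, 0) ≠ 0 := by rwa [hGg.pdy_eventuallyEq.pdy_eq]
  obtain ⟨H, hH, hTaylor, hHdiag⟩ := exists_contDiff_taylor_snd hG
  obtain ⟨r₀, hr₀, s, hs, hs0, hks⟩ := exists_contDiffOn_implicit (contDiff_pdy hG) hG1 hG2
  have hI₀ : (0 : ℝ) ∈ Ioo (-r₀) r₀ := ⟨by linarith, hr₀⟩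
  -- near the origin, `G` restricted to its critical curve satisfies `G = G_x ^ 2`
  have hcurve : ∀ᶠ x in 𝓝 (0 : ℝ), x ∈ Ioo (-r₀) r₀ ∧ G (x, s x) = pdx G (x, s x) ^ 2 := by
    have hcont : ContinuousAt (fun x => (x, s x)) 0 :=
      continuousAt_id.prodMk (hs.contDiffAt (isOpen_Ioo.mem_nhds hI₀)).continuousAt
    have hT : Tendsto (fun x => (x, s x)) (𝓝 0) (𝓝 (0, 0)) := by
      simpa only [ContinuousAt, hs0] using hcont
    filter_upwards [isOpen_Ioo.mem_nhds hI₀, hT.eventually (hV.mem_nhds hV0),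
      hT.eventually (eventually_eventuallyEq_nhds.2 hGg)] with x hx hxV hxG
    have hmul := hN.mul_pdy_eq hV htr hdisc hxV
    rw [← hxG.pdy_eq, ← hxG.pdx_eq, ← hxG.self_of_nhds, hks x hx, mul_zero] at hmul
    exact ⟨hx, by linarith⟩
  obtain ⟨r, hr, hball⟩ := Metric.eventually_nhds_iff_ball.1 hcurve
  rw [Real.ball_eq_Ioo, zero_sub, zero_add] at hball
  have hsr : ContDiffOn ℝ ∞ s (Ioo (-r) r) := hs.mono fun x hx => (hball x hx).1
  have hsAt : ∀ x ∈ Ioo (-r) r, ContDiffAt ℝ ∞ s x := fun x hx =>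
    hsr.contDiffAt (isOpen_Ioo.mem_nhds hx)
  obtain ⟨δ, hδ, hR⟩ := eq_sq_div_four_of_deriv_sq_eq hr (R := fun x => G (x, s x))
    (q := fun x => pdx G (x, s x)) ((contDiff_pdx hG).comp_contDiffOn (contDiffOn_id.prodMk hsr))
    (fun x hx => by
      have hsd : HasDerivAt s (deriv s x) x := ((hsAt x hx).differentiableAt (by simp)).hasDerivAt
      have := hasDerivAt_comp_curve (u := id) (hG.differentiable (by simp) (x, s x))
        (hasDerivAt_id x) hsd
      simpa [hks x (hball x hx).1] using this)
    (fun x hx => (hball x hx).2) (by simp [hs0, hG0])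
  have hHne : H (0, 0, 0) ≠ 0 := by
    rw [hHdiag]
    exact div_ne_zero hG2 two_ne_zero
  obtain ⟨ε, hε, hεH⟩ : ∃ ε : ℝ, (ε = 1 ∨ ε = -1) ∧ 0 < ε * H (0, 0, 0) := by
    rcases hHne.lt_or_gt with h | h
    · exact ⟨-1, .inr rfl, by linarith⟩
    · exact ⟨1, .inl rfl, by linarith⟩
  have hε2 : ε * ε = 1 := by rcases hε with rfl | rfl <;> norm_num
  let m : ℝ × ℝ → ℝ := fun p => ε * H (p.1, p.2, s p.1)
  let φ : ℝ × ℝ → ℝ := fun p => (p.2 - s p.1) * √(m p)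
  have hI : (0 : ℝ) ∈ Ioo (-r) r := ⟨by linarith, hr⟩
  have hm0 : 0 < m (0, 0) := by simpa [m, hs0] using hεH
  have hsfst : ∀ p : ℝ × ℝ, p.1 ∈ Ioo (-r) r → ContDiffAt ℝ ∞ (fun p : ℝ × ℝ => s p.1) p :=
    fun p hp => (hsAt p.1 hp).comp p contDiffAt_fst
  have hm : ∀ p : ℝ × ℝ, p.1 ∈ Ioo (-r) r → ContDiffAt ℝ ∞ m p := fun p hp =>
    contDiffAt_const.mul (hH.contDiffAt.comp p
      (contDiffAt_fst.prodMk (contDiffAt_snd.prodMk (hsfst p hp))))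
  have hφ : ∀ p : ℝ × ℝ, p.1 ∈ Ioo (-r) r → 0 < m p → ContDiffAt ℝ ∞ φ p := fun p hp hmp =>
    (contDiffAt_snd.sub (hsfst p hp)).mul ((hm p hp).sqrt hmp.ne')
  have hφy0 : pdy φ (0, 0) ≠ 0 := by
    have d1 : HasFDerivAt (fun p : ℝ × ℝ => p.2 - s p.1) _ (0, 0) :=
      ((contDiffAt_snd.sub (hsfst (0, 0) hI)).differentiableAt (by simp)).hasFDerivAt
    have d2 : HasFDerivAt (fun p : ℝ × ℝ => √(m p)) _ (0, 0) :=
      (((hm (0, 0) hI).sqrt hm0.ne').differentiableAt (by simp)).hasFDerivAt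
    have d3 : pdy (fun p : ℝ × ℝ => p.2 - s p.1) (0, 0) = 1 := by
      have hsd := ((hsAt 0 hI).differentiableAt (by simp)).hasDerivAt
      have := (hasFDerivAt_snd (𝕜 := ℝ) (p := ((0 : ℝ), (0 : ℝ)))).sub
        (hsd.comp_hasFDerivAt (f := Prod.fst) ((0 : ℝ), (0 : ℝ)) hasFDerivAt_fst)
      refine this.pdy_eq.trans ?_
      simp
    have d4 : pdy φ (0, 0) = √(m (0, 0)) := by
      refine (d1.mul d2).pdy_eq.trans ?_
      rw [pdy] at d3
      simp [d3, hs0]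
    rw [d4]
    exact (Real.sqrt_pos.2 hm0).ne'
  have hfst : ∀ᶠ p : ℝ × ℝ in 𝓝 (0, 0), p.1 ∈ Ioo (-r) r :=
    continuousAt_fst.eventually (isOpen_Ioo.mem_nhds hI)
  have hreg : ∀ᶠ p : ℝ × ℝ in 𝓝 (0, 0), p.1 ∈ Ioo (-r) r ∧ 0 < m p :=
    hfst.and ((hm (0, 0) hI).continuousAt.eventually (lt_mem_nhds hm0))
  obtain ⟨W, hWreg, hW, hW0⟩ := eventually_nhds_iff.1 hreg
  have hφW : ContDiffOn ℝ ∞ φ W := fun p hp =>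
    (hφ p (hWreg p hp).1 (hWreg p hp).2).contDiffWithinAt
  have hφyev : ∀ᶠ p in 𝓝 (0, 0), pdy φ p ≠ 0 :=
    ((contDiffOn_pdy hW hφW).contDiffAt (hW.mem_nhds hW0)).continuousAt.eventually_ne hφy0
  have hall : ∀ᶠ p in 𝓝 ((0 : ℝ), (0 : ℝ)), p ∈ V ∧ p ∈ W ∧ G p = g p ∧ pdy φ p ≠ 0 := by
    filter_upwards [hV.mem_nhds hV0, hW.mem_nhds hW0, hGg, hφyev] with p h1 h2 h3 h4
      using ⟨h1, h2, h3, h4⟩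
  obtain ⟨V', hV', hV'o, hV'0⟩ := eventually_nhds_iff.1 hall
  refine ⟨V', fun p hp => hVU (hV' p hp).1, hV'o, hV'0, ε, hε, δ, hδ, φ,
    hφW.mono fun p hp => (hV' p hp).2.1, by simp [φ, hs0], fun p hp => (hV' p hp).2.2.2,
    fun p hp => ?_⟩
  obtain ⟨-, hpW, hpG, -⟩ := hV' p hp
  obtain ⟨hpI, hmp⟩ := hWreg p hpW
  have hRp := hR p.1 hpI
  rw [← hpG, show G p = G (p.1, p.2) from rfl, hTaylor p.1 p.2 (s p.1),
    hks p.1 (hball p.1 hpI).1, mul_pow, Real.sq_sqrt hmp.le]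
  simp only [m]
  linear_combination hRp - (p.2 - s p.1) ^ 2 * H (p.1, p.2, s p.1) * hε2

end Nijenhuis

theorem stmt5 (U : Set (ℝ × ℝ)) (hU : IsOpen U) (hU0 : (0, 0) ∈ U)
    (g : ℝ × ℝ → ℝ) (hg : ContDiffOn ℝ (⊤ : ℕ∞) g U)
    (h0 : g (0, 0) = 0) (h1 : pdy g (0, 0) = 0) (h2 : pdy (pdy g) (0, 0) ≠ 0) :
    AdmissibleDiscriminantOn U g ↔
      ∃ V : Set (ℝ × ℝ), V ⊆ U ∧ IsOpen V ∧ (0, 0) ∈ V ∧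
        ∃ ε : ℝ, (ε = 1 ∨ ε = -1) ∧
          ∃ δ : ℝ, (δ = 0 ∨ δ = 1) ∧
            ∃ φ : ℝ × ℝ → ℝ, ContDiffOn ℝ (⊤ : ℕ∞) φ V ∧ φ (0, 0) = 0 ∧
              (∀ p ∈ V, pdy φ p ≠ 0) ∧
              (∀ p ∈ V, g p = ε * (φ p) ^ 2 + δ * p.1 ^ 2 / 4) :=
  ⟨AdmissibleDiscriminantOn.exists_normalForm hU hU0 hg h0 h1 h2,
    fun ⟨_, hVU, hV, hV0, _, hε, _, hδ, _, hφ, _, hφy, hgφ⟩ =>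
      admissibleDiscriminantOn_of_normalForm hVU hV hV0 (hg.mono hVU) hε hδ hφ hφy hgφ⟩
end

section
/- Let τ be a smooth function on a neighbourhood of 0 in ℝ with τ(0) = 0, let ε ∈ {1,−1}, and suppose there exists a smooth function h on a neighbourhood of the origin in ℝ² such that h(x,y)·(2εy) = τ'(x)² − τ(x) − ε y² for all (x,y) in that neighbourhood. Then either τ(x) = x²/4 for all x near 0, or τ(x) = 0 for all x near 0. -/
open Real Set

/-- If `f ^ 2` is an antiderivative of `f` and `f'` is continuous, then `f'` only takes the values
`0` and `1 / 2`. -/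
lemma deriv_eq_zero_or_half_of_hasDerivAt_sq {s : Set ℝ} (hs : IsOpen s) {f g : ℝ → ℝ}
    (hsq : ∀ x ∈ s, HasDerivAt (fun t => f t ^ 2) (f x) x)
    (hf : ∀ x ∈ s, HasDerivAt f (g x) x) (hg : ContinuousOn g s) {x : ℝ} (hx : x ∈ s) :
    g x = 0 ∨ g x = 1 / 2 := by
  have half : ∀ z ∈ s, f z ≠ 0 → g z = 1 / 2 := by
    intro z hz hfz
    have h1 := (hsq z hz).unique ((hf z hz).pow 2)
    have h2 : f z * (2 * g z - 1) = 0 := by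
      norm_num at h1
      linarith
    have h3 := (mul_eq_zero.mp h2).resolve_left hfz
    linarith
  by_cases hfx : f x = 0
  · by_cases hgx : g x = 0
    · exact Or.inl hgx
    right
    have hne : ∀ᶠ z in nhdsWithin x {x}ᶜ, f z ≠ 0 := (hf x hx).eventually_ne hgx
    have hs' : ∀ᶠ z in nhdsWithin x {x}ᶜ, z ∈ s := nhdsWithin_le_nhds (hs.mem_nhds hx)
    have hlim : Filter.Tendsto g (nhdsWithin x {x}ᶜ) (nhds (g x)) :=
      (hg.continuousAt (hs.mem_nhds hx)).mono_left nhdsWithin_le_nhds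
    refine tendsto_nhds_unique hlim (tendsto_const_nhds.congr' ?_)
    filter_upwards [hne, hs'] with z hz hzs
    exact (half z hzs hz).symm
  · exact Or.inr (half x hx hfx)

/-- A function with constant derivative `c` on a connected open set, vanishing at `0`, is
multiplication by `c`. -/
lemma eq_mul_of_hasDerivAt_const {s : Set ℝ} (hs : IsOpen s) (hs' : IsPreconnected s)
    (h0 : (0 : ℝ) ∈ s) {f : ℝ → ℝ} {c : ℝ} (hf : ∀ x ∈ s, HasDerivAt f c x) (hf0 : f 0 = 0)
    {x : ℝ} (hx : x ∈ s) : f x = c * x := by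
  have hd : ∀ z ∈ s, HasDerivAt (fun t => f t - c * t) 0 z := by
    intro z hz
    have := (hf z hz).fun_sub ((hasDerivAt_id' z).const_mul c)
    rwa [mul_one, sub_self] at this
  have key := hs.is_const_of_deriv_eq_zero hs'
    (fun z hz => (hd z hz).differentiableAt.differentiableWithinAt)
    (fun z hz => (hd z hz).deriv) hx h0
  simp only [hf0, mul_zero, sub_zero] at key
  linarith

theorem stmt6 (W : Set ℝ) (hW : IsOpen W) (hW0 : (0 : ℝ) ∈ W)
    (τ : ℝ → ℝ) (hτ : ContDiffOn ℝ (⊤ : ℕ∞) τ W) (hτ0 : τ 0 = 0)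
    (ε : ℝ) (hε : ε = 1 ∨ ε = -1)
    (V : Set (ℝ × ℝ)) (hV : IsOpen V) (hV0 : (0, 0) ∈ V)
    (hVW : ∀ p ∈ V, p.1 ∈ W)
    (h : ℝ × ℝ → ℝ) (hh : ContDiffOn ℝ (⊤ : ℕ∞) h V)
    (heq : ∀ p ∈ V, h p * (2 * ε * p.2) = (deriv τ p.1) ^ 2 - τ p.1 - ε * p.2 ^ 2) :
    (∀ᶠ x in nhds (0 : ℝ), τ x = x ^ 2 / 4) ∨ (∀ᶠ x in nhds (0 : ℝ), τ x = 0) := by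
  have hpre : IsOpen ((fun x : ℝ => (x, (0 : ℝ))) ⁻¹' V) := hV.preimage (by fun_prop)
  obtain ⟨r, hr, hball⟩ := Metric.isOpen_iff.mp hpre 0 hV0
  set s : Set ℝ := Metric.ball 0 r
  have hs : IsOpen s := Metric.isOpen_ball
  have hsc : IsPreconnected s := (convex_ball (0 : ℝ) r).isPreconnected
  have h0 : (0 : ℝ) ∈ s := Metric.mem_ball_self hr
  have hsW : s ⊆ W := fun x hx => hVW (x, 0) (hball hx)
  have hsq : ∀ x ∈ s, τ x = deriv τ x ^ 2 := by
    intro x hx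
    have := heq (x, 0) (hball hx)
    norm_num at this
    linarith
  have hτs : ContDiffOn ℝ (⊤ : ℕ∞) τ s := hτ.mono hsW
  have hτ' : ContDiffOn ℝ (⊤ : ℕ∞) (deriv τ) s := hτs.deriv_of_isOpen hs (by simp)
  have hτ'' : ContDiffOn ℝ (⊤ : ℕ∞) (deriv (deriv τ)) s := hτ'.deriv_of_isOpen hs (by simp)
  have hd1 : ∀ x ∈ s, HasDerivAt (fun t => deriv τ t ^ 2) (deriv τ x) x := by
    intro x hx
    have hx' := hs.mem_nhds hx
    refine ((hτs.differentiableOn (by simp)).differentiableAt hx').hasDerivAt.congr_of_eventuallyEq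
      ?_
    filter_upwards [hx'] with z hz
    exact (hsq z hz).symm
  have hd2 : ∀ x ∈ s, HasDerivAt (deriv τ) (deriv (deriv τ) x) x := fun x hx =>
    ((hτ'.differentiableOn (by simp)).differentiableAt (hs.mem_nhds hx)).hasDerivAt
  have hval : MapsTo (deriv (deriv τ)) s {0, 1 / 2} := fun x hx =>
    deriv_eq_zero_or_half_of_hasDerivAt_sq hs hd1 hd2 hτ''.continuousOn hx
  have hconst : ∀ x ∈ s, HasDerivAt (deriv τ) (deriv (deriv τ) 0) x := fun x hx =>
    hsc.constant_of_mapsTo (Set.toFinite _).isDiscrete hτ''.continuousOn hval hx h0 ▸ hd2 x hx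
  have hτ'0 : deriv τ 0 = 0 := by
    have := hsq 0 h0
    rw [hτ0] at this
    exact pow_eq_zero_iff two_ne_zero |>.mp this.symm
  have hlin : ∀ x ∈ s, τ x = (deriv (deriv τ) 0 * x) ^ 2 := fun x hx => by
    rw [hsq x hx, eq_mul_of_hasDerivAt_const hs hsc h0 hconst hτ'0 hx]
  rcases hval h0 with hc | hc
  · right
    filter_upwards [hs.mem_nhds h0] with x hx
    rw [hlin x hx, hc]
    ring
  · left
    filter_upwards [hs.mem_nhds h0] with x hx
    rw [hlin x hx, hc]
    ring
end

section
/- Let τ and β be real-analytic functions on a neighbourhood of 0 in ℝ with τ(0) = β(0) = 0, satisfying the system 3·τ'(x)·β'(x) − τ(x) = 0 and −τ(x)·τ'(x)² + 3·β'(x)² − 3·β(x) = 0 for all x near 0. Then τ ≡ 0 near 0, and either β ≡ 0 near 0 or β(x) = x²/4 for all x near 0. -/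
open Real Set

open Filter Topology

/-- The derivative of a function that vanishes near a point vanishes there. -/
lemma HasDerivAt.eq_zero_of_eventually_eq_zero {f : ℝ → ℝ} {f' x : ℝ} (h : HasDerivAt f f' x)
    (h0 : ∀ᶠ y in 𝓝 x, f y = 0) : f' = 0 :=
  h.unique ((hasDerivAt_const x (0 : ℝ)).congr_of_eventuallyEq h0)

/-- If `3 τ' β' = τ` near `0`, where `β'` vanishes at `0` and `τ` does not vanish identically near
`0`, then `3 k β''(0) = 1`, where `k` is the order of vanishing of `τ` at `0`. -/
lemma exists_nat_mul_deriv_deriv_eq_one {τ β : ℝ → ℝ} (hτ : AnalyticAt ℝ τ 0)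
    (hβ : AnalyticAt ℝ β 0) (hτ0 : τ 0 = 0) (hβ' : deriv β 0 = 0)
    (h : ∀ᶠ x in 𝓝 0, 3 * deriv τ x * deriv β x - τ x = 0) (hne : ¬ ∀ᶠ x in 𝓝 0, τ x = 0) :
    ∃ k : ℕ, 3 * (k : ℝ) * deriv (deriv β) 0 = 1 := by
  obtain ⟨k, g, hg, hg0, hτg⟩ := hτ.exists_eventuallyEq_pow_smul_nonzero_iff.mpr hne
  simp only [sub_zero, smul_eq_mul] at hτg
  refine ⟨k, ?_⟩
  obtain _ | n := k
  · have := hτg.self_of_nhds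
    simp [hτ0] at this
    exact absurd this.symm hg0
  have key : ∀ᶠ x in 𝓝 0,
      3 * (((n + 1 : ℕ) : ℝ) * g x + x * deriv g x) * deriv β x - x * g x = 0 := by
    filter_upwards [h, hτg, hτg.eventually_nhds, hg.eventually_analyticAt] with x hx hx1 hx2 hgx
    rcases eq_or_ne x 0 with rfl | hx0
    · simp [hβ']
    have hd : deriv τ x = ((n + 1 : ℕ) : ℝ) * x ^ n * g x + x ^ (n + 1) * deriv g x := by
      have hmul := (hasDerivAt_pow (n + 1) x).mul hgx.differentiableAt.hasDerivAt
      exact (hmul.congr_of_eventuallyEq hx2).deriv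
    rw [hd, hx1] at hx
    apply mul_left_cancel₀ (pow_ne_zero n hx0)
    linear_combination hx
  have hD := (((((hg.differentiableAt.hasDerivAt.const_mul ((n + 1 : ℕ) : ℝ)).add
    ((hasDerivAt_id (0 : ℝ)).mul hg.deriv.differentiableAt.hasDerivAt)).const_mul 3).mul
    hβ.deriv.differentiableAt.hasDerivAt).sub
    ((hasDerivAt_id (0 : ℝ)).mul hg.differentiableAt.hasDerivAt))
  have hz := hD.eq_zero_of_eventually_eq_zero key
  simp [hβ'] at hz
  apply mul_right_cancel₀ hg0
  push_cast
  linear_combination hz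

/-- If `-τ τ'² + 3 β'² - 3 β = 0` near `0`, where `τ` and `β'` vanish at `0`, then
`β''(0) ∈ {0, 1/2}`. -/
lemma deriv_deriv_mul_eq_zero {τ β : ℝ → ℝ} (hτ : AnalyticAt ℝ τ 0)
    (hβ : AnalyticAt ℝ β 0) (hτ0 : τ 0 = 0) (hβ' : deriv β 0 = 0)
    (h : ∀ᶠ x in 𝓝 0, -(τ x) * (deriv τ x) ^ 2 + 3 * (deriv β x) ^ 2 - 3 * β x = 0) :
    deriv (deriv β) 0 * (2 * deriv (deriv β) 0 - 1) = 0 := by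
  have h1 : ∀ᶠ x in 𝓝 0, -(deriv τ x) ^ 3 - τ x * (2 * deriv τ x * deriv (deriv τ) x)
      + 6 * (deriv β x * deriv (deriv β) x) - 3 * deriv β x = 0 := by
    filter_upwards [h.eventually_nhds, hτ.eventually_analyticAt, hβ.eventually_analyticAt]
      with x hx hτx hβx
    have hD := ((hτx.differentiableAt.hasDerivAt.neg.mul
      (hτx.deriv.differentiableAt.hasDerivAt.pow 2)).add
      ((hβx.deriv.differentiableAt.hasDerivAt.pow 2).const_mul 3)).sub
      (hβx.differentiableAt.hasDerivAt.const_mul 3)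
    have hz := hD.eq_zero_of_eventually_eq_zero hx
    simp at hz
    linear_combination hz
  have hτ' : deriv τ 0 = 0 := by
    have := h1.self_of_nhds
    simpa [hτ0, hβ'] using this
  have dτ := hτ.differentiableAt.hasDerivAt
  have dτ' := hτ.deriv.differentiableAt.hasDerivAt
  have dτ'' := hτ.deriv.deriv.differentiableAt.hasDerivAt
  have dβ' := hβ.deriv.differentiableAt.hasDerivAt
  have dβ'' := hβ.deriv.deriv.differentiableAt.hasDerivAt
  have hD := (((dτ'.pow 3).neg.sub (dτ.mul ((dτ'.const_mul 2).mul dτ''))).add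
    ((dβ'.mul dβ'').const_mul 6)).sub (dβ'.const_mul 3)
  have hz := hD.eq_zero_of_eventually_eq_zero h1
  simp [hτ', hβ', hτ0] at hz
  linear_combination hz / 3

/-- Near a point, a function with zero derivative is constant. -/
lemma eventually_eq_of_eventually_hasDerivAt_zero {f : ℝ → ℝ} {a : ℝ}
    (h : ∀ᶠ x in 𝓝 a, HasDerivAt f 0 x) : ∀ᶠ x in 𝓝 a, f x = f a := by
  obtain ⟨ε, hε, hball⟩ := Metric.eventually_nhds_iff_ball.mp h
  filter_upwards [Metric.ball_mem_nhds a hε] with x hx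
  exact Metric.isOpen_ball.is_const_of_deriv_eq_zero (convex_ball a ε).isPreconnected
    (fun y hy => (hball y hy).differentiableAt.differentiableWithinAt)
    (fun y hy => (hball y hy).deriv) hx (Metric.mem_ball_self hε)

/-- The analytic solutions of `β'² = β` near `0` with `β 0 = 0` are `0` and `x² / 4`. -/
lemma eventually_eq_zero_or_eq_sq_div_four {β : ℝ → ℝ} (hβ : AnalyticAt ℝ β 0) (hβ0 : β 0 = 0)
    (h : ∀ᶠ x in 𝓝 0, (deriv β x) ^ 2 - β x = 0) :
    (∀ᶠ x in 𝓝 0, β x = 0) ∨ ∀ᶠ x in 𝓝 0, β x = x ^ 2 / 4 := by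
  have hβ' : deriv β 0 = 0 := by simpa [hβ0] using h.self_of_nhds
  have h1 : ∀ᶠ x in 𝓝 0, deriv β x * (2 * deriv (deriv β) x - 1) = 0 := by
    filter_upwards [h.eventually_nhds, hβ.eventually_analyticAt] with x hx hβx
    have hD := (hβx.deriv.differentiableAt.hasDerivAt.pow 2).sub hβx.differentiableAt.hasDerivAt
    have hz := hD.eq_zero_of_eventually_eq_zero hx
    simp at hz
    linear_combination hz
  have han : AnalyticAt ℝ (fun x => 2 * deriv (deriv β) x - 1) 0 :=
    (analyticAt_const.mul hβ.deriv.deriv).sub analyticAt_const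
  rcases hβ.deriv.eventually_eq_zero_or_eventually_ne_zero with hz | hnz
  · left
    filter_upwards [h, hz] with x hx hx'
    simpa [hx'] using hx
  right
  have h2 : ∀ᶠ x in 𝓝 0, 2 * deriv (deriv β) x - 1 = 0 := by
    refine han.frequently_zero_iff_eventually_zero.mp (Eventually.frequently ?_)
    filter_upwards [hnz, h1.filter_mono nhdsWithin_le_nhds] with x hx hx1
    exact (mul_eq_zero.mp hx1).resolve_left hx
  have h3 : ∀ᶠ x in 𝓝 0, deriv β x - x / 2 = deriv β 0 - 0 / 2 := by
    apply eventually_eq_of_eventually_hasDerivAt_zero (f := fun x => deriv β x - x / 2)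
    filter_upwards [h2, hβ.eventually_analyticAt] with x hx hβx
    have hD := hβx.deriv.differentiableAt.hasDerivAt.sub ((hasDerivAt_id x).div_const 2)
    exact hD.congr_deriv (by linarith)
  filter_upwards [h, h3] with x hx hx3
  have hd : deriv β x = x / 2 := by linarith
  rw [hd] at hx
  linarith

theorem stmt11 (W : Set ℝ) (hW : IsOpen W) (hW0 : (0 : ℝ) ∈ W)
    (τ β : ℝ → ℝ) (hτ : AnalyticOnNhd ℝ τ W) (hβ : AnalyticOnNhd ℝ β W)
    (hτ0 : τ 0 = 0) (hβ0 : β 0 = 0)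
    (hsys : ∀ x ∈ W,
      3 * deriv τ x * deriv β x - τ x = 0 ∧
      -(τ x) * (deriv τ x) ^ 2 + 3 * (deriv β x) ^ 2 - 3 * β x = 0) :
    ∃ W' : Set ℝ, W' ⊆ W ∧ IsOpen W' ∧ (0 : ℝ) ∈ W' ∧
      (∀ x ∈ W', τ x = 0) ∧
      ((∀ x ∈ W', β x = 0) ∨ (∀ x ∈ W', β x = x ^ 2 / 4)) := by
  have hWn : ∀ᶠ x in 𝓝 (0 : ℝ), x ∈ W := hW.mem_nhds hW0
  have hτa := hτ 0 hW0
  have hβa := hβ 0 hW0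
  have e1 := hWn.mono fun x hx => (hsys x hx).1
  have e2 := hWn.mono fun x hx => (hsys x hx).2
  have hβ' : deriv β 0 = 0 := by simpa [hτ0, hβ0] using e2.self_of_nhds
  have hτz : ∀ᶠ x in 𝓝 0, τ x = 0 := by
    by_contra hne
    obtain ⟨k, hk⟩ := exists_nat_mul_deriv_deriv_eq_one hτa hβa hτ0 hβ' e1 hne
    rcases mul_eq_zero.mp (deriv_deriv_mul_eq_zero hτa hβa hτ0 hβ' e2) with hb | hb
    · simp [hb] at hk
    · have h32 : (3 * k : ℝ) = 2 := by linear_combination 2 * hk - 3 * (k : ℝ) * hb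
      have : 3 * k = 2 := by exact_mod_cast h32
      omega
  have hβz := eventually_eq_zero_or_eq_sq_div_four hβa hβ0 (by
    filter_upwards [e2, hτz] with x hx hx'
    rw [hx'] at hx
    linarith)
  rcases hβz with hβz | hβz
  · obtain ⟨U, hU, hUo, hU0⟩ := eventually_nhds_iff.mp (hWn.and (hτz.and hβz))
    exact ⟨U, fun x hx => (hU x hx).1, hUo, hU0, fun x hx => (hU x hx).2.1,
      Or.inl fun x hx => (hU x hx).2.2⟩
  · obtain ⟨U, hU, hUo, hU0⟩ := eventually_nhds_iff.mp (hWn.and (hτz.and hβz))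
    exact ⟨U, fun x hx => (hU x hx).1, hUo, hU0, fun x hx => (hU x hx).2.1,
      Or.inr fun x hx => (hU x hx).2.2⟩
end

section
/- The following hold on U = ℝ²: the quadruple (a,b,c,d) = (x/2, 3y², y/3, x/2) is a Nijenhuis operator with a+d = x and discriminant ((a+d)/2)² − (a·d − b·c) = y³; and the quadruple (a,b,c,d) = (x, 3y², y/3, 0) is a Nijenhuis operator with a+d = x and discriminant x²/4 + y³. -/
open Real Set

/-- The Fréchet derivative of a function of the first coordinate only. -/
theorem hasFDerivAt_comp_fst {f : ℝ → ℝ} {f' : ℝ} {p : ℝ × ℝ} (h : HasDerivAt f f' p.1) :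
    HasFDerivAt (fun q : ℝ × ℝ => f q.1) (f' • ContinuousLinearMap.fst ℝ ℝ ℝ) p :=
  h.comp_hasFDerivAt p hasFDerivAt_fst

/-- The Fréchet derivative of a function of the second coordinate only. -/
theorem hasFDerivAt_comp_snd {f : ℝ → ℝ} {f' : ℝ} {p : ℝ × ℝ} (h : HasDerivAt f f' p.2) :
    HasFDerivAt (fun q : ℝ × ℝ => f q.2) (f' • ContinuousLinearMap.snd ℝ ℝ ℝ) p :=
  h.comp_hasFDerivAt p hasFDerivAt_snd

theorem pdx_comp_fst {f : ℝ → ℝ} {f' : ℝ} {p : ℝ × ℝ} (h : HasDerivAt f f' p.1) :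
    pdx (fun q => f q.1) p = f' := by
  simp [pdx, (hasFDerivAt_comp_fst h).fderiv]

theorem pdy_comp_fst {f : ℝ → ℝ} {f' : ℝ} {p : ℝ × ℝ} (h : HasDerivAt f f' p.1) :
    pdy (fun q => f q.1) p = 0 := by
  simp [pdy, (hasFDerivAt_comp_fst h).fderiv]

theorem pdx_comp_snd {f : ℝ → ℝ} {f' : ℝ} {p : ℝ × ℝ} (h : HasDerivAt f f' p.2) :
    pdx (fun q => f q.2) p = 0 := by
  simp [pdx, (hasFDerivAt_comp_snd h).fderiv]

theorem pdy_comp_snd {f : ℝ → ℝ} {f' : ℝ} {p : ℝ × ℝ} (h : HasDerivAt f f' p.2) :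
    pdy (fun q => f q.2) p = f' := by
  simp [pdy, (hasFDerivAt_comp_snd h).fderiv]

theorem stmt12 :
    (IsNijenhuisOn Set.univ
        (fun p => p.1 / 2) (fun p => 3 * p.2 ^ 2) (fun p => p.2 / 3) (fun p => p.1 / 2) ∧
      (∀ p : ℝ × ℝ, p.1 / 2 + p.1 / 2 = p.1) ∧
      (∀ p : ℝ × ℝ,
        ((p.1 / 2 + p.1 / 2) / 2) ^ 2 -
          ((p.1 / 2) * (p.1 / 2) - (3 * p.2 ^ 2) * (p.2 / 3)) = p.2 ^ 3)) ∧
    (IsNijenhuisOn Set.univ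
        (fun p => p.1) (fun p => 3 * p.2 ^ 2) (fun p => p.2 / 3) (fun _ => 0) ∧
      (∀ p : ℝ × ℝ, p.1 + (0 : ℝ) = p.1) ∧
      (∀ p : ℝ × ℝ,
        ((p.1 + 0) / 2) ^ 2 - (p.1 * 0 - (3 * p.2 ^ 2) * (p.2 / 3)) =
          p.1 ^ 2 / 4 + p.2 ^ 3)) := by
  have hcube : (fun q : ℝ × ℝ => 3 * q.2 ^ 2 * (q.2 / 3)) = fun q => q.2 ^ 3 := by
    funext q; ring
  have hhalf : (fun q : ℝ × ℝ => q.1 / 2 + q.1 / 2) = fun q => q.1 := by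
    funext q; ring
  have hzero : (fun q : ℝ × ℝ => q.1 + (0 : ℝ)) = fun q => q.1 := by
    funext q; ring
  have hcx (p : ℝ × ℝ) : pdx (fun q => q.2 ^ 3) p = 0 :=
    pdx_comp_snd (hasDerivAt_pow 3 p.2)
  have hcy (p : ℝ × ℝ) : pdy (fun q => q.2 ^ 3) p = 3 * p.2 ^ 2 := by
    simpa using pdy_comp_snd (hasDerivAt_pow 3 p.2)
  have hx (p : ℝ × ℝ) : pdx (fun q => q.1) p = 1 := pdx_comp_fst (hasDerivAt_id p.1)
  have hy (p : ℝ × ℝ) : pdy (fun q => q.1) p = 0 := pdy_comp_fst (hasDerivAt_id p.1)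
  have hd (p : ℝ × ℝ) : pdx (fun _ => (0 : ℝ)) p = 0 :=
    pdx_comp_fst (hasDerivAt_const p.1 (0 : ℝ))
  refine ⟨⟨⟨?_, ?_, ?_, ?_, fun p _ => ?_⟩, fun p => by ring, fun p => by ring⟩,
    ⟨⟨?_, ?_, ?_, ?_, fun p _ => ?_⟩, fun p => by ring, fun p => by ring⟩⟩
  case refine_5 =>
    simp only [hcube, hhalf, hcx, hcy, hx, hy]
    constructor <;> ring
  case refine_10 =>
    simp only [hcube, hzero, hcx, hcy, hx, hy, hd]
    constructor <;> ring
  all_goals exact ContDiff.contDiffOn (by fun_prop)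
end

section
/- Define G : ℝ → ℝ by G(y) = exp(−1/√y) for y > 0 and G(y) = 0 for y ≤ 0. Then G is smooth (infinitely differentiable) on ℝ, yet there is no open neighbourhood W of 0 and smooth function h : W → ℝ with h(y)·G'(y) = G(y) for all y ∈ W (indeed, any such h would have to equal 2·y^{3/2} for y > 0, which has no smooth extension through 0). -/
open Real Set

/-- The flat function `G(y) = exp(-1/√y)` for `y > 0`, `0` for `y ≤ 0`. -/
noncomputable def flatG : ℝ → ℝ := fun y => if 0 < y then Real.exp (-1 / Real.sqrt y) else 0

open Polynomial in
theorem hasDerivAt_polynomial_eval_inv_sqrt_mul (p : ℝ[X]) (x : ℝ) :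
    HasDerivAt (fun x ↦ p.eval (√x)⁻¹ * expNegInvGlue (√x))
      ((C (1 / 2) * X ^ 3 * (p - derivative p)).eval (√x)⁻¹ * expNegInvGlue (√x)) x := by
  rcases lt_trichotomy x 0 with hx | rfl | hx
  · rw [Real.sqrt_eq_zero_of_nonpos hx.le, expNegInvGlue.zero, mul_zero]
    refine (hasDerivAt_const _ 0).congr_of_eventuallyEq ?_
    filter_upwards [gt_mem_nhds hx] with y hy
    rw [Real.sqrt_eq_zero_of_nonpos hy.le, expNegInvGlue.zero, mul_zero]
  · rw [Real.sqrt_zero, expNegInvGlue.zero, mul_zero, hasDerivAt_iff_tendsto_slope]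
    have hsqrt : Filter.Tendsto Real.sqrt (nhds 0) (nhds 0) := by
      simpa using Real.continuous_sqrt.tendsto 0
    refine (((expNegInvGlue.tendsto_polynomial_inv_mul_zero (p * X ^ 2)).comp hsqrt).mono_left
      inf_le_left).congr fun x ↦ ?_
    rcases le_or_gt x 0 with hx | hx
    · simp [slope_def_field, Real.sqrt_eq_zero_of_nonpos hx]
    · simp [slope_def_field, div_eq_mul_inv, mul_right_comm, Real.sq_sqrt hx.le]
  · have hs : 0 < √x := Real.sqrt_pos.2 hx
    convert! (expNegInvGlue.hasDerivAt_polynomial_eval_inv_mul p (√x)).comp x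
      (Real.hasDerivAt_sqrt hx.ne') using 1
    simp only [eval_mul, eval_pow, eval_X, eval_C]
    field_simp

open Polynomial in
theorem contDiff_polynomial_eval_inv_sqrt_mul {n : ℕ∞} (p : ℝ[X]) :
    ContDiff ℝ n (fun x ↦ p.eval (√x)⁻¹ * expNegInvGlue (√x)) := by
  have hd (p : ℝ[X]) : Differentiable ℝ (fun x ↦ p.eval (√x)⁻¹ * expNegInvGlue (√x)) :=
    fun x ↦ (hasDerivAt_polynomial_eval_inv_sqrt_mul p x).differentiableAt
  apply contDiff_all_iff_nat.2 (fun m => ?_) n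
  induction m generalizing p with
  | zero => exact contDiff_zero.2 (hd p).continuous
  | succ m ihm =>
    rw [show ((m + 1 : ℕ) : WithTop ℕ∞) = m + 1 from rfl]
    refine contDiff_succ_iff_deriv.2 ⟨hd p, by simp, ?_⟩
    convert! ihm (C (1 / 2) * X ^ 3 * (p - derivative p)) using 2
    exact (hasDerivAt_polynomial_eval_inv_sqrt_mul p _).deriv

theorem flatG_eq_expNegInvGlue_sqrt : flatG = fun x ↦ expNegInvGlue (√x) := by
  funext x
  rcases le_or_gt x 0 with hx | hx
  · simp [flatG, hx.not_gt, Real.sqrt_eq_zero_of_nonpos hx]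
  · simp [flatG, hx, expNegInvGlue, (Real.sqrt_pos.2 hx).not_ge, neg_div]

theorem contDiff_flatG {n : ℕ∞} : ContDiff ℝ n flatG := by
  simpa [flatG_eq_expNegInvGlue_sqrt] using contDiff_polynomial_eval_inv_sqrt_mul (n := n) 1

theorem deriv_flatG_of_pos {y : ℝ} (hy : 0 < y) : deriv flatG y = flatG y / (2 * (y * √y)) := by
  have h := (hasDerivAt_polynomial_eval_inv_sqrt_mul 1 y).deriv
  simp only [Polynomial.eval_one, one_mul] at h
  have hs : 0 < √y := Real.sqrt_pos.2 hy
  rw [flatG_eq_expNegInvGlue_sqrt, h]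
  simp only [Polynomial.eval_mul, Polynomial.eval_pow, Polynomial.eval_X, Polynomial.eval_C,
    Polynomial.derivative_one, sub_zero, Polynomial.eval_one]
  field_simp
  rw [Real.sq_sqrt hy.le, mul_comm]

theorem flatG_pos {y : ℝ} (hy : 0 < y) : 0 < flatG y := by
  simp [flatG, hy, Real.exp_pos]

/-- A function equal to `c * √y` for small `y > 0`, with `c ≠ 0`, is not differentiable at `0`. -/
theorem not_differentiableAt_zero_of_eventuallyEq_const_mul_sqrt {g : ℝ → ℝ} {c : ℝ} (hc : c ≠ 0)
    (hg : g =ᶠ[nhdsWithin 0 (Ioi 0)] fun y ↦ c * √y) : ¬ DifferentiableAt ℝ g 0 := by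
  intro hd
  have h0 : g 0 = 0 := by
    have h1 : Filter.Tendsto g (nhdsWithin 0 (Ioi 0)) (nhds (g 0)) :=
      hd.continuousAt.tendsto.mono_left nhdsWithin_le_nhds
    have h2 : Filter.Tendsto (fun y ↦ c * √y) (nhdsWithin 0 (Ioi 0)) (nhds (c * √0)) :=
      ((continuous_const.mul Real.continuous_sqrt).tendsto 0).mono_left nhdsWithin_le_nhds
    simpa using tendsto_nhds_unique h1 (h2.congr' hg.symm)
  have h1 : HasDerivWithinAt (fun y ↦ g y ^ 2) 0 (Ioi 0) 0 := by
    simpa [h0] using (hd.hasDerivAt.fun_pow 2).hasDerivWithinAt (s := Ioi 0)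
  have h2 : HasDerivWithinAt (fun y ↦ g y ^ 2) (c ^ 2) (Ioi 0) 0 := by
    have h3 : HasDerivWithinAt (fun y : ℝ ↦ c ^ 2 * y) (c ^ 2) (Ioi 0) 0 := by
      simpa using ((hasDerivAt_id (0 : ℝ)).const_mul (c ^ 2)).hasDerivWithinAt (s := Ioi 0)
    refine h3.congr_of_eventuallyEq ?_ (by simp [h0])
    filter_upwards [hg, self_mem_nhdsWithin] with y hy hpos
    rw [hy, mul_pow, Real.sq_sqrt (le_of_lt hpos)]
  exact pow_ne_zero 2 hc ((uniqueDiffWithinAt_Ioi (0 : ℝ)).eq_deriv _ h2 h1)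

theorem stmt14 :
    ContDiff ℝ (⊤ : ℕ∞) flatG ∧
    ¬ ∃ W : Set ℝ, IsOpen W ∧ (0 : ℝ) ∈ W ∧
        ∃ h : ℝ → ℝ, ContDiffOn ℝ (⊤ : ℕ∞) h W ∧ ∀ y ∈ W, h y * deriv flatG y = flatG y := by
  refine ⟨contDiff_flatG, ?_⟩
  rintro ⟨W, hW, h0, h, hsmooth, heq⟩
  have hformula : ∀ y ∈ W ∩ Ioi 0, h y = 2 * (y * √y) := by
    rintro y ⟨hyW, hy : 0 < y⟩
    have hs : 0 < √y := Real.sqrt_pos.2 hy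
    have hG := (flatG_pos hy).ne'
    have := heq y hyW
    rw [deriv_flatG_of_pos hy] at this
    field_simp at this
    linarith
  have hC2 : ContDiffOn ℝ (1 + 1) h W := by
    rw [one_add_one_eq_two]
    exact contDiffOn_infty.1 hsmooth 2
  have hC1 := ((contDiffOn_succ_iff_deriv_of_isOpen hW).1 hC2).2.2
  refine not_differentiableAt_zero_of_eventuallyEq_const_mul_sqrt (g := deriv h)
    (three_ne_zero (α := ℝ)) ?_
    ((hC1.differentiableOn one_ne_zero).differentiableAt (hW.mem_nhds h0))
  filter_upwards [self_mem_nhdsWithin, mem_nhdsWithin_of_mem_nhds (hW.mem_nhds h0)]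
    with y (hy : 0 < y) hyW
  have hs : 0 < √y := Real.sqrt_pos.2 hy
  have hev : h =ᶠ[nhds y] fun y ↦ 2 * (y * √y) :=
    Filter.eventuallyEq_of_mem ((hW.inter isOpen_Ioi).mem_nhds ⟨hyW, hy⟩) hformula
  rw [hev.deriv_eq,
    (((hasDerivAt_id' y).fun_mul (Real.hasDerivAt_sqrt hy.ne')).const_mul 2).deriv]
  field_simp
  rw [Real.sq_sqrt hy.le]
  ring
end

section
/- Let m ≥ k ≥ 2 be natural numbers and let a, b be smooth functions on a neighbourhood of 0 in ℝ of the form a(x) = x^m·v(x) and b(x) = x^k·u(x) with v, u smooth and u(0) ≠ 0 (so b has a zero of order exactly k and a has a zero of order at least m at 0). Then there exist an open neighbourhood V of the origin in ℝ² and a smooth function H on V such that H(x,y)·b(x) = b'(x)²·y² + (2·a'(x)·b'(x) − b(x))·y + (a'(x)² − a(x)) on V. Consequently, g(x,y) = a(x) + b(x)·y is an admissible discriminant. -/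
open Real Set

/-- If `H * g_y = g_x ^ 2 - g` on `V`, then `[[x / 2 + g_x, g_y], [-H, x / 2 - g_x]]` is a
Nijenhuis operator with trace `x` and discriminant `g`. -/
theorem admissibleDiscriminantOn_of_mul_pdy_eq {U V : Set (ℝ × ℝ)} {g H : ℝ × ℝ → ℝ}
    (hVU : V ⊆ U) (hV : IsOpen V) (h0 : (0, 0) ∈ V) (hg : ContDiffOn ℝ (⊤ : ℕ∞) g V)
    (hH : ContDiffOn ℝ (⊤ : ℕ∞) H V)
    (h : ∀ p ∈ V, H p * pdy g p = pdx g p ^ 2 - g p) :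
    AdmissibleDiscriminantOn U g := by
  have hg' : ContDiffOn ℝ (⊤ : ℕ∞) (fderiv ℝ g) V := hg.fderiv_of_isOpen hV (by simp)
  have hgx : ContDiffOn ℝ (⊤ : ℕ∞) (pdx g) V := hg'.clm_apply contDiffOn_const
  have hgy : ContDiffOn ℝ (⊤ : ℕ∞) (pdy g) V := hg'.clm_apply contDiffOn_const
  have hx : ContDiffOn ℝ (⊤ : ℕ∞) (fun p : ℝ × ℝ => p.1 / 2) V :=
    (contDiff_fst.div_const 2).contDiffOn
  refine ⟨V, hVU, hV, h0, fun p => p.1 / 2 + pdx g p, pdy g, fun p => -H p,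
    fun p => p.1 / 2 - pdx g p, ⟨hx.add hgx, hgy, hH.neg, hx.sub hgx, fun p hp => ?_⟩,
    fun p _ => by ring, fun p hp => by linear_combination -h p hp⟩
  have hpV : V ∈ nhds p := hV.mem_nhds hp
  have dg : HasFDerivAt g (fderiv ℝ g p) p :=
    ((hg.contDiffAt hpV).differentiableAt (by simp)).hasFDerivAt
  have dgx : HasFDerivAt (pdx g) (fderiv ℝ (pdx g) p) p :=
    ((hgx.contDiffAt hpV).differentiableAt (by simp)).hasFDerivAt
  have dx : HasFDerivAt (fun q : ℝ × ℝ => q.1) (ContinuousLinearMap.fst ℝ ℝ ℝ) p :=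
    hasFDerivAt_fst
  have dx2 : HasFDerivAt (fun q : ℝ × ℝ => q.1 / 2)
      ((2 : ℝ)⁻¹ • ContinuousLinearMap.fst ℝ ℝ ℝ) p := by
    simpa only [div_eq_mul_inv] using dx.mul_const (2 : ℝ)⁻¹
  have dprod : HasFDerivAt (fun q => pdy g q * -H q)
      (fderiv ℝ g p - (2 * pdx g p) • fderiv ℝ (pdx g) p) p := by
    have hsq : HasFDerivAt (fun q => g q - pdx g q ^ 2)
        (fderiv ℝ g p - (2 * pdx g p) • fderiv ℝ (pdx g) p) p := by
      simpa using dg.fun_sub (dgx.pow 2)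
    refine hsq.congr_of_eventuallyEq ?_
    filter_upwards [hpV] with q hq
    linear_combination -h q hq
  have htr : (fun q : ℝ × ℝ => q.1 / 2 + pdx g q + (q.1 / 2 - pdx g q)) = fun q => q.1 := by
    funext q; ring
  have pdy_fst_entry : pdy (fun q => q.1 / 2 + pdx g q) p = pdy (pdx g) p := by
    rw [pdy, (dx2.fun_add dgx).fderiv]; simp [pdy]
  have pdx_snd_entry : pdx (fun q => q.1 / 2 - pdx g q) p = 1 / 2 - pdx (pdx g) p := by
    rw [pdx, (dx2.fun_sub dgx).fderiv]; simp [pdx]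
  have pdy_prod : pdy (fun q => pdy g q * -H q) p = pdy g p - 2 * pdx g p * pdy (pdx g) p := by
    rw [pdy, dprod.fderiv]; simp [pdy]
  have pdx_prod : pdx (fun q => pdy g q * -H q) p = pdx g p - 2 * pdx g p * pdx (pdx g) p := by
    rw [pdx, dprod.fderiv]; simp [pdx]
  have pdx_trace : pdx (fun q : ℝ × ℝ => q.1) p = 1 := by simp [pdx, dx.fderiv]
  have pdy_trace : pdy (fun q : ℝ × ℝ => q.1) p = 0 := by simp [pdy, dx.fderiv]
  constructor
  · rw [htr, pdy_fst_entry, pdy_prod, pdx_trace]; ring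
  · rw [htr, pdx_snd_entry, pdx_prod, pdy_trace]; ring

/-- The differential of `(x, y) ↦ a x + b x * y`. -/
theorem hasFDerivAt_add_mul_snd {a b : ℝ → ℝ} {p : ℝ × ℝ} (ha : DifferentiableAt ℝ a p.1)
    (hb : DifferentiableAt ℝ b p.1) :
    HasFDerivAt (fun q : ℝ × ℝ => a q.1 + b q.1 * q.2)
      ((deriv a p.1 + deriv b p.1 * p.2) • ContinuousLinearMap.fst ℝ ℝ ℝ +
        b p.1 • ContinuousLinearMap.snd ℝ ℝ ℝ) p := by
  have hfst : HasFDerivAt (fun q : ℝ × ℝ => q.1) (ContinuousLinearMap.fst ℝ ℝ ℝ) p :=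
    hasFDerivAt_fst
  have hsnd : HasFDerivAt (fun q : ℝ × ℝ => q.2) (ContinuousLinearMap.snd ℝ ℝ ℝ) p :=
    hasFDerivAt_snd
  have := (ha.hasDerivAt.comp_hasFDerivAt p hfst).add
    ((hb.hasDerivAt.comp_hasFDerivAt p hfst).mul hsnd)
  refine this.congr_fderiv ?_
  ext <;> simp [mul_comm]

/-- Derivative of a function that agrees with `x ^ (n + 1) * w x` on an open set. -/
theorem deriv_of_eqOn_pow_succ_mul {n : ℕ} {W : Set ℝ} (hW : IsOpen W) {f w : ℝ → ℝ} {x : ℝ}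
    (hx : x ∈ W) (hw : DifferentiableAt ℝ w x) (hf : EqOn f (fun t => t ^ (n + 1) * w t) W) :
    deriv f x = x ^ n * ((n + 1) * w x + x * deriv w x) := by
  rw [(hf.eventuallyEq_of_mem (hW.mem_nhds hx)).deriv_eq,
    ((hasDerivAt_pow (n + 1) x).fun_mul hw.hasDerivAt).deriv]
  push_cast [Nat.add_sub_cancel]
  ring

theorem stmt15 (m k : ℕ) (hk : 2 ≤ k) (hmk : k ≤ m)
    (W : Set ℝ) (hW : IsOpen W) (hW0 : (0 : ℝ) ∈ W)
    (v u : ℝ → ℝ) (hv : ContDiffOn ℝ (⊤ : ℕ∞) v W) (hu : ContDiffOn ℝ (⊤ : ℕ∞) u W) (hu0 : u 0 ≠ 0)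
    (a b : ℝ → ℝ) (ha : ContDiffOn ℝ (⊤ : ℕ∞) a W) (hb : ContDiffOn ℝ (⊤ : ℕ∞) b W)
    (hab : ∀ x ∈ W, a x = x ^ m * v x ∧ b x = x ^ k * u x) :
    (∃ V : Set (ℝ × ℝ), V ⊆ W ×ˢ (Set.univ : Set ℝ) ∧ IsOpen V ∧ (0, 0) ∈ V ∧
      ∃ H : ℝ × ℝ → ℝ, ContDiffOn ℝ (⊤ : ℕ∞) H V ∧
        ∀ p ∈ V, H p * b p.1 =
          (deriv b p.1) ^ 2 * p.2 ^ 2 + (2 * deriv a p.1 * deriv b p.1 - b p.1) * p.2 +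
            ((deriv a p.1) ^ 2 - a p.1)) ∧
    AdmissibleDiscriminantOn (W ×ˢ (Set.univ : Set ℝ)) (fun p => a p.1 + b p.1 * p.2) := by
  obtain ⟨n, rfl⟩ := Nat.exists_eq_add_of_le' hk
  obtain ⟨j, rfl⟩ := Nat.exists_eq_add_of_le' hmk
  set P : ℝ → ℝ := fun x => (((j + n + 1 : ℕ) : ℝ) + 1) * v x + x * deriv v x
  set Q : ℝ → ℝ := fun x => (((n + 1 : ℕ) : ℝ) + 1) * u x + x * deriv u x
  set H : ℝ × ℝ → ℝ := fun p =>
    (p.1 ^ n * Q p.1 ^ 2 * p.2 ^ 2 + 2 * p.1 ^ (j + n) * P p.1 * Q p.1 * p.2 +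
      p.1 ^ (2 * j + n) * P p.1 ^ 2 - p.1 ^ j * v p.1) / u p.1 - p.2 with hHdef
  set W' : Set ℝ := W ∩ u ⁻¹' {0}ᶜ
  set V : Set (ℝ × ℝ) := W' ×ˢ univ
  have hW'o : IsOpen W' := hu.continuousOn.isOpen_inter_preimage hW isOpen_compl_singleton
  have hVU : V ⊆ W ×ˢ univ := prod_mono inter_subset_left subset_rfl
  have hV : IsOpen V := hW'o.prod isOpen_univ
  have hV0 : ((0, 0) : ℝ × ℝ) ∈ V := ⟨⟨hW0, hu0⟩, trivial⟩
  have hmap : MapsTo Prod.fst V W := fun p hp => hp.1.1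
  have lift : ∀ {f : ℝ → ℝ}, ContDiffOn ℝ (⊤ : ℕ∞) f W →
      ContDiffOn ℝ (⊤ : ℕ∞) (fun p : ℝ × ℝ => f p.1) V :=
    fun hf => hf.comp contDiffOn_fst hmap
  have hv' : ContDiffOn ℝ (⊤ : ℕ∞) (deriv v) W := hv.deriv_of_isOpen hW (by simp)
  have hu' : ContDiffOn ℝ (⊤ : ℕ∞) (deriv u) W := hu.deriv_of_isOpen hW (by simp)
  have hPs : ContDiffOn ℝ (⊤ : ℕ∞) P W :=
    (contDiffOn_const.mul hv).add (contDiffOn_id.mul hv')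
  have hQs : ContDiffOn ℝ (⊤ : ℕ∞) Q W :=
    (contDiffOn_const.mul hu).add (contDiffOn_id.mul hu')
  have hdiff : ∀ {f : ℝ → ℝ}, ContDiffOn ℝ (⊤ : ℕ∞) f W → ∀ x ∈ W, DifferentiableAt ℝ f x :=
    fun hf x hx => (hf.contDiffAt (hW.mem_nhds hx)).differentiableAt (by simp)
  have hHs : ContDiffOn ℝ (⊤ : ℕ∞) H V := by
    have hP2 := lift hPs
    have hQ2 := lift hQs
    have hv2 := lift hv
    have hu2 := lift hu
    refine ContDiffOn.sub (ContDiffOn.div ?_ hu2 fun p hp => hp.1.2) contDiffOn_snd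
    have h1 : ContDiffOn ℝ (⊤ : ℕ∞) (fun p : ℝ × ℝ => p.1) V := contDiffOn_fst
    have h2 : ContDiffOn ℝ (⊤ : ℕ∞) (fun p : ℝ × ℝ => p.2) V := contDiffOn_snd
    exact (((((h1.pow n).mul (hQ2.pow 2)).mul (h2.pow 2)).add
      ((((contDiffOn_const.mul (h1.pow (j + n))).mul hP2).mul hQ2).mul h2)).add
      ((h1.pow (2 * j + n)).mul (hP2.pow 2))).sub ((h1.pow j).mul hv2)
  have hHeq : ∀ p ∈ V, H p * b p.1 =
      (deriv b p.1) ^ 2 * p.2 ^ 2 + (2 * deriv a p.1 * deriv b p.1 - b p.1) * p.2 +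
        ((deriv a p.1) ^ 2 - a p.1) := by
    intro p hp
    have hpW : p.1 ∈ W := hp.1.1
    have hup : u p.1 ≠ 0 := hp.1.2
    have hda : deriv a p.1 = p.1 ^ (j + n + 1) * P p.1 :=
      deriv_of_eqOn_pow_succ_mul hW hpW (hdiff hv _ hpW) fun x hx => (hab x hx).1
    have hdb : deriv b p.1 = p.1 ^ (n + 1) * Q p.1 :=
      deriv_of_eqOn_pow_succ_mul hW hpW (hdiff hu _ hpW) fun x hx => (hab x hx).2
    rw [hda, hdb, (hab _ hpW).1, (hab _ hpW).2]
    simp only [hHdef]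
    clear_value P Q
    field_simp
    ring
  refine ⟨⟨V, hVU, hV, hV0, H, hHs, hHeq⟩, ?_⟩
  refine admissibleDiscriminantOn_of_mul_pdy_eq hVU hV hV0
    ((lift ha).add ((lift hb).mul contDiffOn_snd)) hHs fun p hp => ?_
  have hpW : p.1 ∈ W := hp.1.1
  have hd := (hasFDerivAt_add_mul_snd (hdiff ha _ hpW) (hdiff hb _ hpW)).fderiv
  have hx : pdx (fun q => a q.1 + b q.1 * q.2) p = deriv a p.1 + deriv b p.1 * p.2 := by
    simp [pdx, hd]
  have hy : pdy (fun q => a q.1 + b q.1 * q.2) p = b p.1 := by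
    simp [pdy, hd]
  rw [hx, hy, hHeq p hp]
  ring
end

section
/- Let m, k be natural numbers with k ≥ 1 and m = 0 or m ≥ 2, let a, b ∈ ℝ with b ≠ 0, let ε ∈ {1,−1}, and set g(x,y) = ε·x^m·(a·x + b·y)^k. Then there exists a smooth function h on ℝ² (in fact a polynomial) such that h·∂g/∂y = (∂g/∂x)² − g everywhere on ℝ². In particular, g is an admissible discriminant. -/
open Real Set

theorem ContDiff.pdx {g : ℝ × ℝ → ℝ} (hg : ContDiff ℝ (⊤ : ℕ∞) g) :
    ContDiff ℝ (⊤ : ℕ∞) (pdx g) :=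
  (hg.fderiv_right (by simp)).clm_apply contDiff_const

theorem ContDiff.pdy {g : ℝ × ℝ → ℝ} (hg : ContDiff ℝ (⊤ : ℕ∞) g) :
    ContDiff ℝ (⊤ : ℕ∞) (pdy g) :=
  (hg.fderiv_right (by simp)).clm_apply contDiff_const

/-- A smooth solution `h` of `h * ∂g/∂y = (∂g/∂x)² - g` yields the Nijenhuis operator
`[[x/2 + ∂g/∂x, ∂g/∂y], [-h, x/2 - ∂g/∂x]]` with trace `x` and discriminant `g`. -/
theorem admissibleDiscriminantOn_univ_of_mul_pdy_eq {g h : ℝ × ℝ → ℝ}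
    (hg : ContDiff ℝ (⊤ : ℕ∞) g) (hh : ContDiff ℝ (⊤ : ℕ∞) h)
    (hgh : ∀ p, h p * pdy g p = (pdx g p) ^ 2 - g p) :
    AdmissibleDiscriminantOn Set.univ g := by
  have hx : ContDiff ℝ (⊤ : ℕ∞) fun p : ℝ × ℝ => p.1 / 2 := contDiff_fst.div_const 2
  refine ⟨Set.univ, subset_rfl, isOpen_univ, Set.mem_univ _, fun p => p.1 / 2 + pdx g p,
    pdy g, fun p => -h p, fun p => p.1 / 2 - pdx g p,
    ⟨(hx.add hg.pdx).contDiffOn, hg.pdy.contDiffOn, hh.neg.contDiffOn,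
      (hx.sub hg.pdx).contDiffOn, fun p _ => ?_⟩, fun p _ => by ring, fun p _ => ?_⟩
  · have hbc : (fun q => pdy g q * -h q) = fun q => g q - pdx g q ^ 2 := by
      funext q
      linear_combination -hgh q
    have htr : (fun q : ℝ × ℝ => q.1 / 2 + pdx g q + (q.1 / 2 - pdx g q)) = fun q => q.1 := by
      funext q
      ring
    have hu := (hg.pdx.differentiable (by simp) p).hasFDerivAt
    have hg' := (hg.differentiable (by simp) p).hasFDerivAt
    have hx' : HasFDerivAt (fun q : ℝ × ℝ => q.1 / 2)
        ((2 : ℝ)⁻¹ • ContinuousLinearMap.fst ℝ ℝ ℝ) p := by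
      simpa only [div_eq_mul_inv] using hasFDerivAt_fst.mul_const (2 : ℝ)⁻¹
    have e₁ := (hx'.add hu).fderiv
    have e₂ := (hx'.sub hu).fderiv
    have e₃ := (hg'.sub (hu.pow 2)).fderiv
    have e₄ := (hasFDerivAt_fst (𝕜 := ℝ) (p := p)).fderiv
    simp only [Pi.add_def, Pi.sub_def] at e₁ e₂ e₃
    rw [hbc, htr]
    simp only [pdy, pdx] at *
    constructor
    · rw [e₁, e₃, e₄]
      simp
      ring
    · rw [e₂, e₃, e₄]
      simp
      ring
  · linear_combination -hgh p

/-- The derivative of `ε * x ^ m * (a * x + b * y) ^ k` in the direction `v`. -/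
theorem fderiv_mul_pow_mul_pow_apply (m k : ℕ) (a b ε : ℝ) (p v : ℝ × ℝ) :
    fderiv ℝ (fun p : ℝ × ℝ => ε * p.1 ^ m * (a * p.1 + b * p.2) ^ k) p v =
      ε * (m * p.1 ^ (m - 1) * v.1) * (a * p.1 + b * p.2) ^ k +
        ε * p.1 ^ m * (k * (a * p.1 + b * p.2) ^ (k - 1) * (a * v.1 + b * v.2)) := by
  have h₁ := hasFDerivAt_fst (𝕜 := ℝ) (p := p)
  have h₂ := hasFDerivAt_snd (𝕜 := ℝ) (p := p)
  have h := ((h₁.pow m).const_mul ε).mul (((h₁.const_mul a).add (h₂.const_mul b)).pow k)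
  simp only [Pi.add_def, Pi.mul_def] at h
  rw [h.fderiv]
  simp
  ring

theorem stmt16 (m k : ℕ) (hk : 1 ≤ k) (hm : m = 0 ∨ 2 ≤ m)
    (a b : ℝ) (hb : b ≠ 0) (ε : ℝ) (hε : ε = 1 ∨ ε = -1)
    (g : ℝ × ℝ → ℝ) (hg : g = fun p => ε * p.1 ^ m * (a * p.1 + b * p.2) ^ k) :
    (∃ h : ℝ × ℝ → ℝ, ContDiff ℝ (⊤ : ℕ∞) h ∧
      ∀ p : ℝ × ℝ, h p * pdy g p = (pdx g p) ^ 2 - g p) ∧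
    AdmissibleDiscriminantOn Set.univ g := by
  have hg_smooth : ContDiff ℝ (⊤ : ℕ∞) g := by
    rw [hg]
    fun_prop
  have hk₀ : (k : ℝ) ≠ 0 := by exact_mod_cast (by omega : k ≠ 0)
  obtain ⟨h, hh, hgh⟩ : ∃ h : ℝ × ℝ → ℝ, ContDiff ℝ (⊤ : ℕ∞) h ∧
      ∀ p : ℝ × ℝ, h p * pdy g p = (pdx g p) ^ 2 - g p := by
    refine ⟨fun p => (k * b)⁻¹ * (ε * p.1 ^ (m - 2) * (a * p.1 + b * p.2) ^ (k - 1) *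
      (m * (a * p.1 + b * p.2) + k * a * p.1 ^ (min m 1)) ^ 2 - (a * p.1 + b * p.2)),
      by fun_prop, fun p => ?_⟩
    obtain ⟨n, rfl⟩ : ∃ n, k = n + 1 := ⟨k - 1, by omega⟩
    simp only [pdx, pdy, hg, fderiv_mul_pow_mul_pow_apply]
    generalize a * p.1 + b * p.2 = l
    rcases hm with rfl | hm
    · simp
      simp at hk₀
      field_simp
      ring
    · obtain ⟨r, rfl⟩ : ∃ r, m = r + 2 := ⟨m - 2, by omega⟩
      have e : min (r + 2) 1 = 1 := by omega
      simp only [e, Nat.add_sub_cancel, show r + 2 - 1 = r + 1 by omega]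
      field_simp
      ring
  exact ⟨⟨h, hh, hgh⟩, admissibleDiscriminantOn_univ_of_mul_pdy_eq hg_smooth hh hgh⟩
end

section
/- Let g(x,y) be a homogeneous polynomial in two real variables of degree n with n ≠ 2, such that ∂g/∂y is not identically zero, and suppose there exists a smooth function h on a neighbourhood of the origin in ℝ² with h·∂g/∂y = (∂g/∂x)² − g on that neighbourhood. Then there exist ε ∈ {1,−1}, natural numbers m, k with m ≠ 1 and k ≥ 1, and real numbers a, b with b ≠ 0, such that g(x,y) = ε·x^m·(a·x + b·y)^k. -/
open Real Set

/-- A polynomial function of two real variables is smooth. -/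
lemma contDiff_eval_pair (P : MvPolynomial (Fin 2) ℝ) :
    ContDiff ℝ 1 (fun p : ℝ × ℝ => MvPolynomial.eval ![p.1, p.2] P) := by
  induction P using MvPolynomial.induction_on with
  | C a => simpa using contDiff_const
  | add p q hp hq => simpa using hp.add hq
  | mul_X p i hp =>
    fin_cases i
    · simpa using hp.mul contDiff_fst
    · simpa using hp.mul contDiff_snd

/-- A real polynomial with `(X + c) q' = k q` is a multiple of `(X + c) ^ k`. -/
lemma Polynomial.eq_C_mul_pow_of_X_add_C_mul_derivative (q : Polynomial ℝ) (c : ℝ) (k : ℕ)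
    (hq : (Polynomial.X + Polynomial.C c) * Polynomial.derivative q = Polynomial.C (k : ℝ) * q) :
    ∃ K : ℝ, q = Polynomial.C K * (Polynomial.X + Polynomial.C c) ^ k := by
  set r := q.comp (Polynomial.X - Polynomial.C c) with hr
  have hqr : q = r.comp (Polynomial.X + Polynomial.C c) := by
    simp [hr, Polynomial.comp_assoc]
  have hr' : Polynomial.X * Polynomial.derivative r = Polynomial.C (k : ℝ) * r := by
    have := congrArg (fun s => Polynomial.comp s (Polynomial.X - Polynomial.C c)) hq
    simpa [hr, Polynomial.derivative_comp] using this
  have hrk : r = Polynomial.C (r.coeff k) * Polynomial.X ^ k := by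
    ext j
    rw [Polynomial.coeff_C_mul, Polynomial.coeff_X_pow]
    by_cases hjk : j = k
    · simp [hjk]
    · simp only [hjk, if_false, mul_zero]
      have hj := congrArg (fun s => Polynomial.coeff s j) hr'
      rw [Polynomial.coeff_C_mul] at hj
      have hjc : (j : ℝ) ≠ k := by exact_mod_cast hjk
      rcases j with _ | j
      · simp only [Polynomial.mul_coeff_zero, Polynomial.coeff_X_zero, zero_mul] at hj
        have hk : (k : ℝ) ≠ 0 := fun h0 => hjc (by simp [h0])
        simpa [hk] using hj.symm
      · rw [Polynomial.coeff_X_mul, Polynomial.coeff_derivative] at hj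
        push_cast at hjc
        have : ((j : ℝ) + 1 - k) * r.coeff (j + 1) = 0 := by linarith
        exact (mul_eq_zero.1 this).resolve_left (sub_ne_zero.2 hjc)
  refine ⟨r.coeff k, ?_⟩
  conv_lhs => rw [hqr, hrk]
  simp

/-- A nonzero real polynomial with `(a + b X) q' = -q` is a multiple of a power of a monic
linear polynomial. -/
lemma Polynomial.exists_eq_C_mul_pow_of_linear_mul_derivative (q : Polynomial ℝ) (hq0 : q ≠ 0)
    (a b : ℝ)
    (hq : (Polynomial.C a + Polynomial.C b * Polynomial.X) * Polynomial.derivative q = -q) :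
    1 ≤ q.natDegree ∧
      ∃ K c : ℝ, K ≠ 0 ∧ q = Polynomial.C K * (Polynomial.X + Polynomial.C c) ^ q.natDegree := by
  have hk : 1 ≤ q.natDegree := by
    by_contra hk
    have h0 : q.natDegree = 0 := by omega
    rw [Polynomial.derivative_of_natDegree_zero h0, mul_zero] at hq
    exact hq0 (neg_eq_zero.1 hq.symm)
  refine ⟨hk, ?_⟩
  have hlead : b * q.natDegree = -1 := by
    obtain ⟨k, hkk⟩ : ∃ k, q.natDegree = k + 1 := ⟨q.natDegree - 1, by omega⟩
    have hc : q.coeff (k + 1) ≠ 0 := by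
      rw [← hkk]; exact Polynomial.leadingCoeff_ne_zero.2 hq0
    have h2 : q.coeff (k + 1 + 1) = 0 := Polynomial.coeff_eq_zero_of_natDegree_lt (by omega)
    have := congrArg (fun s => Polynomial.coeff s (k + 1)) hq
    simp only [add_mul, mul_assoc, Polynomial.coeff_add, Polynomial.coeff_C_mul,
      Polynomial.coeff_X_mul, Polynomial.coeff_derivative, Polynomial.coeff_neg, h2] at this
    rw [hkk]
    push_cast
    apply mul_right_cancel₀ hc
    linarith
  have hb : b ≠ 0 := by rintro rfl; simp at hlead
  obtain ⟨K, hK⟩ := Polynomial.eq_C_mul_pow_of_X_add_C_mul_derivative q (a / b) q.natDegree (by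
    have h1 : (Polynomial.X + Polynomial.C (a / b) : Polynomial ℝ)
        = Polynomial.C (b⁻¹) * (Polynomial.C a + Polynomial.C b * Polynomial.X) := by
      rw [mul_add, ← mul_assoc, ← Polynomial.C_mul, ← Polynomial.C_mul, inv_mul_cancel₀ hb]
      rw [Polynomial.C_1, one_mul, div_eq_inv_mul, add_comm]
    have h2 : (q.natDegree : ℝ) = -b⁻¹ := by field_simp; linarith
    rw [h1, mul_assoc, hq, h2]
    simp)
  refine ⟨K, a / b, ?_, hK⟩
  rintro rfl
  exact hq0 (by simpa using hK)

/-- The partial derivatives of a homogeneous function of degree `n + 1` are homogeneous of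
degree `n`. -/
lemma fderiv_smul_of_homogeneous {n : ℕ} {g : ℝ × ℝ → ℝ} (hd : Differentiable ℝ g)
    (hom : ∀ (t : ℝ) (p : ℝ × ℝ), g (t • p) = t ^ (n + 1) * g p) {t : ℝ} (ht : t ≠ 0)
    (p v : ℝ × ℝ) : fderiv ℝ g (t • p) v = t ^ n * fderiv ℝ g p v := by
  have h1 : HasFDerivAt (fun q : ℝ × ℝ => g (t • q))
      ((fderiv ℝ g (t • p)).comp (t • ContinuousLinearMap.id ℝ (ℝ × ℝ))) p :=
    (hd (t • p)).hasFDerivAt.comp p ((hasFDerivAt_id p).const_smul t)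
  have h2 : HasFDerivAt (fun q : ℝ × ℝ => g (t • q)) (t ^ (n + 1) • fderiv ℝ g p) p := by
    simp only [hom]
    exact (hd p).hasFDerivAt.const_mul _
  have h3 := DFunLike.congr_fun (h1.unique h2) v
  simp only [ContinuousLinearMap.comp_apply, smul_apply,
    ContinuousLinearMap.id_apply, map_smul, smul_eq_mul] at h3
  apply mul_left_cancel₀ ht
  rw [h3]; ring

/-- If `g` is homogeneous of degree `n + 1 ≠ 2` and `h g_y = g_x ^ 2 - g` near the origin with `h`
differentiable at the origin, then `-g` is the product of `g_y` and the differential of `h` at the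
origin, and `g_x` vanishes wherever `g_y` does. -/
lemma linear_part_of_discriminant_equation {n : ℕ} (hn : n ≠ 1) {g h : ℝ × ℝ → ℝ}
    (hd : Differentiable ℝ g)
    (hom : ∀ (t : ℝ) (p : ℝ × ℝ), g (t • p) = t ^ (n + 1) * g p)
    (hh : DifferentiableAt ℝ h 0)
    (heq : ∀ᶠ p in nhds (0 : ℝ × ℝ), h p * pdy g p = (pdx g p) ^ 2 - g p) (p : ℝ × ℝ) :
    fderiv ℝ h 0 p * pdy g p = -g p ∧ (pdy g p = 0 → pdx g p = 0) := by
  have hline : HasDerivAt (fun t : ℝ => t • p) p 0 := by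
    simpa using (hasDerivAt_id (0 : ℝ)).smul_const p
  have htend : Filter.Tendsto (fun t : ℝ => t • p) (nhds 0) (nhds 0) := by
    have := hline.continuousAt.tendsto
    rwa [zero_smul] at this
  have hev : ∀ᶠ t in nhdsWithin (0 : ℝ) {0}ᶜ,
      h (t • p) * pdy g p = t ^ n * (pdx g p) ^ 2 - t * g p := by
    filter_upwards [(htend.eventually heq).filter_mono nhdsWithin_le_nhds, self_mem_nhdsWithin]
      with t ht ht0
    have ht0 : t ≠ 0 := ht0
    simp only [pdx, pdy, fderiv_smul_of_homogeneous hd hom ht0, hom] at ht ⊢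
    apply mul_left_cancel₀ (pow_ne_zero n ht0)
    linear_combination ht
  have hL : HasDerivAt (fun t : ℝ => h (t • p) * pdy g p) (fderiv ℝ h 0 p * pdy g p) 0 := by
    have h0 : HasFDerivAt h (fderiv ℝ h 0) ((0 : ℝ) • p) := by
      rw [zero_smul]; exact hh.hasFDerivAt
    exact (h0.comp_hasDerivAt (0 : ℝ) hline).mul_const _
  have hR : HasDerivAt (fun t : ℝ => t ^ n * (pdx g p) ^ 2 - t * g p) (-g p) 0 := by
    have hz : (n : ℝ) * 0 ^ (n - 1) = 0 := by
      rcases n with _ | _ | n <;> simp_all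
    have := ((hasDerivAt_pow n (0 : ℝ)).mul_const ((pdx g p) ^ 2)).sub
      ((hasDerivAt_id (0 : ℝ)).mul_const (g p))
    rw [hz] at this
    exact this.congr_deriv (by simp)
  have hev0 := (hL.continuousAt.eventuallyEq_nhds_iff_eventuallyEq_nhdsNE
    hR.continuousAt).1 hev
  have hlin : fderiv ℝ h 0 p * pdy g p = -g p := hL.unique (hR.congr_of_eventuallyEq hev0)
  refine ⟨hlin, fun hy => ?_⟩
  rw [hy, mul_zero] at hlin
  obtain ⟨t, ht, ht0⟩ := (hev.and self_mem_nhdsWithin).exists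
  have ht0 : t ≠ 0 := ht0
  have hg0 : g p = 0 := by linarith
  rw [hy, hg0] at ht
  have : t ^ n * (pdx g p) ^ 2 = 0 := by linarith
  simpa [ht0] using this

/-- A nonzero homogeneous polynomial of degree `n` in two variables with `l g_y = -g` for a linear
form `l` is a product of powers of `x` and of a linear form involving `y`. -/
lemma exists_eq_mul_pow_of_linear_mul_pdy {n : ℕ} {P : MvPolynomial (Fin 2) ℝ}
    (hP : P.IsHomogeneous n) {g : ℝ × ℝ → ℝ}
    (hg : ∀ p : ℝ × ℝ, g p = MvPolynomial.eval ![p.1, p.2] P)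
    (hd : Differentiable ℝ g) (hom : ∀ (t : ℝ) (p : ℝ × ℝ), g (t • p) = t ^ n * g p)
    (hg0 : ∃ p, g p ≠ 0) (l : ℝ × ℝ →L[ℝ] ℝ) (hl : ∀ p, l p * pdy g p = -g p) :
    ∃ m k : ℕ, 1 ≤ k ∧ ∃ K c : ℝ, K ≠ 0 ∧
      ∀ p : ℝ × ℝ, g p = K * p.1 ^ m * (p.2 + c * p.1) ^ k := by
  set q : Polynomial ℝ := MvPolynomial.aeval ![1, Polynomial.X] P with hq
  have hqg : ∀ y : ℝ, q.eval y = g (1, y) := by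
    intro y
    rw [hg, hq, ← Polynomial.coe_evalRingHom, MvPolynomial.aeval_def, MvPolynomial.hom_eval₂,
      MvPolynomial.eval, MvPolynomial.coe_eval₂Hom]
    congr 1
    · ext; simp
    · funext i; fin_cases i <;> simp
  have hscale : ∀ p : ℝ × ℝ, p.1 ≠ 0 → g p = p.1 ^ n * q.eval (p.2 / p.1) := by
    intro p hp
    rw [hqg, ← hom]
    congr 1
    ext
    · simp
    · simp; field_simp
  have hdense : Dense {p : ℝ × ℝ | p.1 ≠ 0} := by
    have : {p : ℝ × ℝ | p.1 ≠ 0} = ({0}ᶜ : Set ℝ) ×ˢ (Set.univ : Set ℝ) := by ext; simp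
    rw [this]
    exact (dense_compl_singleton (0 : ℝ)).prod dense_univ
  have hq0 : q ≠ 0 := by
    intro hq0
    obtain ⟨p, hp⟩ := hg0
    have : g = fun _ => 0 := hd.continuous.ext_on hdense continuous_const
      (fun p hp => by simp [hscale p hp, hq0])
    exact hp (by rw [this])
  have hqd : ∀ y : ℝ, (Polynomial.derivative q).eval y = pdy g (1, y) := by
    intro y
    have h1 : HasDerivAt (fun y : ℝ => ((1 : ℝ), y)) (0, 1) y :=
      (hasDerivAt_const y (1 : ℝ)).prodMk (hasDerivAt_id y)
    have h2 := (hd (1, y)).hasFDerivAt.comp_hasDerivAt y h1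
    have h3 := q.hasDerivAt y
    have h4 : (fun y => q.eval y) = g ∘ fun y : ℝ => ((1 : ℝ), y) := funext hqg
    rw [h4] at h3
    exact h3.unique h2
  have hode : (Polynomial.C (l (1, 0)) + Polynomial.C (l (0, 1)) * Polynomial.X)
      * Polynomial.derivative q = -q := by
    apply Polynomial.funext
    intro y
    have hly : l (1, y) = l (1, 0) + l (0, 1) * y := by
      have : ((1 : ℝ), y) = (1, 0) + y • (0, 1) := by simp
      rw [this, map_add, map_smul, smul_eq_mul, mul_comm]
    have := hl (1, y)
    rw [hly, ← hqd, ← hqg] at this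
    simpa using this
  obtain ⟨hk, K, c, hK, hqK⟩ :=
    Polynomial.exists_eq_C_mul_pow_of_linear_mul_derivative q hq0 _ _ hode
  have hkn : q.natDegree ≤ n := by
    have := MvPolynomial.aeval_natDegree_le P hP.totalDegree_le ![1, Polynomial.X] (n := 1)
      (by intro i; fin_cases i <;> simp)
    simpa using this
  refine ⟨n - q.natDegree, q.natDegree, hk, K, c, hK, ?_⟩
  have hcont : Continuous fun p : ℝ × ℝ =>
      K * p.1 ^ (n - q.natDegree) * (p.2 + c * p.1) ^ q.natDegree := by fun_prop
  refine fun p => congrFun (hd.continuous.ext_on hdense hcont fun p hp => ?_) p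
  have hp : p.1 ≠ 0 := hp
  have hev : q.eval (p.2 / p.1) = K * (p.2 / p.1 + c) ^ q.natDegree := by
    conv_lhs => rw [hqK]
    simp
  have hsplit : p.1 ^ n = p.1 ^ (n - q.natDegree) * p.1 ^ q.natDegree := by
    rw [← pow_add, Nat.sub_add_cancel hkn]
  have hlin : p.2 + c * p.1 = p.1 * (p.2 / p.1 + c) := by field_simp
  change g p = K * p.1 ^ (n - q.natDegree) * (p.2 + c * p.1) ^ q.natDegree
  rw [hscale p hp, hev, hsplit, hlin, mul_pow]
  ring

theorem stmt17 (n : ℕ) (hn : n ≠ 2) (P : MvPolynomial (Fin 2) ℝ)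
    (hP : P.IsHomogeneous n)
    (g : ℝ × ℝ → ℝ) (hg : ∀ p : ℝ × ℝ, g p = MvPolynomial.eval ![p.1, p.2] P)
    (hgy : ∃ p : ℝ × ℝ, pdy g p ≠ 0)
    (V : Set (ℝ × ℝ)) (hV : IsOpen V) (hV0 : (0, 0) ∈ V)
    (h : ℝ × ℝ → ℝ) (hh : ContDiffOn ℝ (⊤ : ℕ∞) h V)
    (heq : ∀ p ∈ V, h p * pdy g p = (pdx g p) ^ 2 - g p) :
    ∃ ε : ℝ, (ε = 1 ∨ ε = -1) ∧
      ∃ m k : ℕ, m ≠ 1 ∧ 1 ≤ k ∧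
        ∃ A B : ℝ, B ≠ 0 ∧
          ∀ p : ℝ × ℝ, g p = ε * p.1 ^ m * (A * p.1 + B * p.2) ^ k := by
  have hd : Differentiable ℝ g := by
    rw [funext hg]
    exact (contDiff_eval_pair P).differentiable one_ne_zero
  have hom : ∀ (t : ℝ) (p : ℝ × ℝ), g (t • p) = t ^ n * g p := by
    intro t p
    have hvec : ![(t • p).1, (t • p).2] = t • ![p.1, p.2] := by
      ext i; fin_cases i <;> simp
    rw [hg, hg, hvec, MvPolynomial.eval_eq, MvPolynomial.eval_eq, Finset.mul_sum]
    refine Finset.sum_congr rfl fun d hdP => ?_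
    have hdeg : ∑ i ∈ d.support, d i = n := by
      rw [← hP (MvPolynomial.mem_support_iff.1 hdP)]
      simp [Finsupp.weight_apply, Finsupp.sum]
    simp only [Pi.smul_apply, smul_eq_mul, mul_pow, Finset.prod_mul_distrib,
      Finset.prod_pow_eq_pow_sum, hdeg]
    ring
  obtain ⟨p₀, hp₀⟩ := hgy
  obtain ⟨n, rfl⟩ : ∃ j, n = j + 1 := by
    refine Nat.exists_eq_succ_of_ne_zero ?_
    rintro rfl
    have hc : g = fun _ => g 0 := by
      funext p
      simpa using (hom 0 p).symm
    rw [hc] at hp₀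
    simp [pdy] at hp₀
  have hV0' : V ∈ nhds (0 : ℝ × ℝ) := hV.mem_nhds hV0
  have hlin := linear_part_of_discriminant_equation (n := n) (by omega) hd hom
    ((hh.contDiffAt hV0').differentiableAt (by simp))
    (Filter.eventually_of_mem hV0' heq)
  have hg0 : ∃ p, g p ≠ 0 := by
    by_contra! hg0
    rw [show g = fun _ => 0 from funext hg0] at hp₀
    simp [pdy] at hp₀
  obtain ⟨m, k, hk, K, c, hK, hform⟩ :=
    exists_eq_mul_pow_of_linear_mul_pdy hP hg hd hom hg0 _ fun p => (hlin p).1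
  have hm : m ≠ 1 := by
    rintro rfl
    have hy : pdy g (0, 1) = 0 := by
      have h1 : HasDerivAt (fun y : ℝ => ((0 : ℝ), y)) (0, 1) 1 :=
        (hasDerivAt_const 1 (0 : ℝ)).prodMk (hasDerivAt_id 1)
      have h2 := (hd (0, 1)).hasFDerivAt.comp_hasDerivAt (1 : ℝ) h1
      have h3 : (g ∘ fun y : ℝ => ((0 : ℝ), y)) = fun _ => 0 := by
        funext y; simp [hform]
      rw [h3] at h2
      exact h2.unique (hasDerivAt_const _ _)
    have hx : pdx g (0, 1) = K := by
      have h1 : HasDerivAt (fun x : ℝ => (x, (1 : ℝ))) (1, 0) 0 :=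
        (hasDerivAt_id 0).prodMk (hasDerivAt_const 0 (1 : ℝ))
      have h2 := (hd (0, 1)).hasFDerivAt.comp_hasDerivAt (0 : ℝ) h1
      have h3 : (g ∘ fun x : ℝ => (x, (1 : ℝ))) = fun x => x * (K * (1 + c * x) ^ k) := by
        funext x; simp [hform]; ring
      have h4 : DifferentiableAt ℝ (fun x : ℝ => K * (1 + c * x) ^ k) 0 := by fun_prop
      have h5 := (hasDerivAt_id (0 : ℝ)).mul h4.hasDerivAt
      rw [h3] at h2
      have h6 := h2.unique h5
      simpa [pdx] using h6
    exact hK (hx ▸ (hlin (0, 1)).2 hy)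
  have hk0 : k ≠ 0 := by omega
  obtain ⟨ε, hε, hKε⟩ : ∃ ε : ℝ, (ε = 1 ∨ ε = -1) ∧ K = ε * |K| := by
    rcases le_total 0 K with h0 | h0
    · exact ⟨1, Or.inl rfl, by simp [abs_of_nonneg h0]⟩
    · exact ⟨-1, Or.inr rfl, by simp [abs_of_nonpos h0]⟩
  set r : ℝ := |K| ^ ((k : ℝ)⁻¹) with hr
  have hrk : r ^ k = |K| := Real.rpow_inv_natCast_pow (abs_nonneg K) hk0
  have hr0 : r ≠ 0 := (Real.rpow_pos_of_pos (abs_pos.2 hK) _).ne'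
  refine ⟨ε, hε, m, k, hm, hk, r * c, r, hr0, fun p => ?_⟩
  have hfac : r * c * p.1 + r * p.2 = r * (p.2 + c * p.1) := by ring
  rw [hform p, hfac, mul_pow, hrk]
  conv_lhs => rw [hKε]
  ring
end

section
/- Let k ≥ 1 be a natural number, a, b ∈ ℝ with b ≠ 0, ε ∈ {1,−1}, and set g(x,y) = ε·x·(a·x + b·y)^k. Then there is no open neighbourhood V of the origin in ℝ² and smooth function h on V satisfying h·∂g/∂y = (∂g/∂x)² − g on V. -/
open Real Set

/-- The differential of `x * u` at a point of the line `x = 0` is `u dx`. -/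
theorem hasFDerivAt_mul_fst_mul {u : ℝ × ℝ → ℝ} {t : ℝ} (ε : ℝ)
    (hu : DifferentiableAt ℝ u (0, t)) :
    HasFDerivAt (fun p : ℝ × ℝ => ε * p.1 * u p)
      (u (0, t) • ε • ContinuousLinearMap.fst ℝ ℝ ℝ) (0, t) := by
  have hx : HasFDerivAt (fun p : ℝ × ℝ => ε * p.1)
      (ε • ContinuousLinearMap.fst ℝ ℝ ℝ) (0, t) :=
    hasFDerivAt_fst.const_mul ε
  have hmul := hx.mul hu.hasFDerivAt
  simp only [mul_zero, zero_smul, zero_add] at hmul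
  exact hmul

theorem stmt18 (k : ℕ) (hk : 1 ≤ k) (a b : ℝ) (hb : b ≠ 0)
    (ε : ℝ) (hε : ε = 1 ∨ ε = -1)
    (g : ℝ × ℝ → ℝ) (hg : g = fun p => ε * p.1 * (a * p.1 + b * p.2) ^ k) :
    ¬ ∃ V : Set (ℝ × ℝ), IsOpen V ∧ (0, 0) ∈ V ∧
        ∃ h : ℝ × ℝ → ℝ, ContDiffOn ℝ (⊤ : ℕ∞) h V ∧
          ∀ p ∈ V, h p * pdy g p = (pdx g p) ^ 2 - g p := by
  rintro ⟨V, hVo, hV0, h, -, heq⟩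
  have hmem : ∀ᶠ t : ℝ in nhds 0, ((0 : ℝ), t) ∈ V :=
    (Continuous.prodMk_right (0 : ℝ)).continuousAt.eventually (hVo.mem_nhds hV0)
  obtain ⟨t, htV, ht⟩ :=
    ((hmem.filter_mono nhdsWithin_le_nhds).and (self_mem_nhdsWithin (s := {(0 : ℝ)}ᶜ))).exists
  have hd : HasFDerivAt g
      ((a * 0 + b * t) ^ k • ε • ContinuousLinearMap.fst ℝ ℝ ℝ) (0, t) := by
    rw [hg]
    exact hasFDerivAt_mul_fst_mul (u := fun p => (a * p.1 + b * p.2) ^ k) ε (by fun_prop)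
  have key := heq _ htV
  have hε0 : ε ≠ 0 := by rcases hε with rfl | rfl <;> norm_num
  simp only [pdx, pdy, hd.fderiv] at key
  simp [hg] at key
  exact pow_ne_zero 2 (mul_ne_zero (pow_ne_zero k (mul_ne_zero hb ht)) hε0) key.symm
end
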